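/- Suppose C and D are crumpled n-cubes, U_C and U_D are closed neighborhoods of Bd C in C and of Bd D in D respectively, H : U_C → U_D is a homeomorphism with H(Bd C) = Bd D, and Int D is simply connected. Then (C, D, H|_{Bd C}) ∈ W_n. (Theorem 3.2) -/

import Mathlib

noncomputable section

open Metric Set unitInterval

/-- The ambient Euclidean space `ℝ^{n+1}` in which the sphere `S^n` lives. -/
abbrev Amb (n : ℕ) := EuclideanSpace ℝ (Fin (n + 1))

/-- The unit sphere `S^n` inside `ℝ^{n+1}`. -/
def Sph (n : ℕ) : Set (Amb n) := Metric.sphere 0 1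

/-- A crumpled `n`-cube: the union of the image `bd` of a topological embedding of the
sphere `S^{n-1}` into `S^n` together with one of the connected components `int` of
`S^n \ bd`. -/
structure CrumpledCube (n : ℕ) where
  bd : Set (Amb n)
  int : Set (Amb n)
  bd_subset_sphere : bd ⊆ Sph n
  exists_embedding : ∃ e : ↥(Sph (n - 1)) → Amb n,
      Continuous e ∧ Function.Injective e ∧ Set.range e = bd
  int_component : ∃ x, x ∈ Sph n \ bd ∧ int = connectedComponentIn (Sph n \ bd) x

namespace CrumpledCube

/-- The underlying set of a crumpled cube. -/
def carrier {n : ℕ} (C : CrumpledCube n) : Set (Amb n) := C.bd ∪ C.int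

lemma bd_subset_carrier {n : ℕ} (C : CrumpledCube n) : C.bd ⊆ C.carrier :=
  Set.subset_union_left

end CrumpledCube

/-- `f : C → D` is a map associated with the triple `(C, D, h)`: it is continuous,
restricts to `h` on `Bd C`, and satisfies `f⁻¹(Bd D) = Bd C`. -/
def IsAssociatedMap {n : ℕ} (C D : CrumpledCube n) (h : ↥C.bd ≃ₜ ↥D.bd)
    (f : ↥C.carrier → ↥D.carrier) : Prop :=
  Continuous f ∧
    (∀ (x : ↥C.carrier) (hx : (x : Amb n) ∈ C.bd),
      ((f x : ↥D.carrier) : Amb n) = ((h ⟨(x : Amb n), hx⟩ : ↥D.bd) : Amb n)) ∧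
    (∀ x : ↥C.carrier, ((f x : ↥D.carrier) : Amb n) ∈ D.bd ↔ (x : Amb n) ∈ C.bd)

/-- The triple `(C, D, h)` belongs to the collection `𝒲_n`. -/
def MemW {n : ℕ} (C D : CrumpledCube n) (h : ↥C.bd ≃ₜ ↥D.bd) : Prop :=
  ∃ f : ↥C.carrier → ↥D.carrier, IsAssociatedMap C D h f

/-- The image `h(T)` of a subset `T` of `Bd C` under a boundary homeomorphism
`h : Bd C → Bd D`, as a subset of the ambient space. -/
def bdImage {n : ℕ} {C D : CrumpledCube n} (h : ↥C.bd ≃ₜ ↥D.bd) (T : Set (Amb n)) :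
    Set (Amb n) :=
  (fun x : ↥C.bd => ((h x : ↥D.bd) : Amb n)) '' {x : ↥C.bd | (x : Amb n) ∈ T}

/-- `T` is a homotopy taming set for the crumpled cube `C`. -/
def IsHomotopyTamingSet {n : ℕ} (C : CrumpledCube n) (T : Set (Amb n)) : Prop :=
  T ⊆ C.bd ∧
    ∀ (m : C(I × I, ↥C.carrier)) (ε : ℝ), 0 < ε →
      ∃ m' : C(I × I, ↥C.carrier),
        (∀ x, dist (m x) (m' x) < ε) ∧ ∀ x, ((m' x : ↥C.carrier) : Amb n) ∈ T ∪ C.int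

/-- `Bd C` is locally collared in `C` at the point `p`. -/
def LocallyCollaredAt {n : ℕ} (C : CrumpledCube n) (p : ↥C.carrier) : Prop :=
  ∃ N : Set ↥C.carrier, IsOpen N ∧ p ∈ N ∧
    ∃ φ : ↥N ≃ₜ ↥(N ∩ {x : ↥C.carrier | (x : Amb n) ∈ C.bd}) × ↥(Set.Ico (0 : ℝ) 1),
      ∀ (x : ↥N) (hx : ((x : ↥C.carrier) : Amb n) ∈ C.bd),
        φ x = (⟨(x : ↥C.carrier), ⟨x.2, hx⟩⟩, ⟨0, ⟨le_rfl, zero_lt_one⟩⟩)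

/-- The wild set of a crumpled cube: the points of `Bd C` at which `Bd C` fails to be
locally collared in `C`. -/
def wildSet {n : ℕ} (C : CrumpledCube n) : Set (Amb n) :=
  {p | ∃ hp : p ∈ C.bd, ¬ LocallyCollaredAt C ⟨p, C.bd_subset_carrier hp⟩}

/-- `C` is strictly wilder than `D`. -/
def StrictlyWilder {n : ℕ} (C D : CrumpledCube n) : Prop :=
  (∃ h : ↥C.bd ≃ₜ ↥D.bd, MemW C D h) ∧ ∀ H : ↥D.bd ≃ₜ ↥C.bd, ¬ MemW D C H

/-- A crumpled `n`-cube is a closed `n`-cell-complement if the complement of its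
interior in `S^n` is an `n`-cell. -/
def IsClosedCellComplement {n : ℕ} (C : CrumpledCube n) : Prop :=
  Nonempty (↥(Sph n \ C.int) ≃ₜ ↥(Metric.closedBall (0 : EuclideanSpace ℝ (Fin n)) 1))

namespace Cubical

variable {X Y Z : Type*} [TopologicalSpace X] [TopologicalSpace Y] [TopologicalSpace Z]

/-- The standard cube `I^k`. -/
abbrev Cb (k : ℕ) := Fin k → I

/-- The inclusion of the face `x i = e` of the cube. -/
def face {k : ℕ} (i : Fin (k + 1)) (e : I) : C(Cb k, Cb (k + 1)) :=
  ⟨fun x => i.insertNth (α := fun _ => I) e x, by fun_prop⟩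

@[simp] lemma face_apply {k : ℕ} (i : Fin (k + 1)) (e : I) (x : Cb k) :
    face i e x = i.insertNth (α := fun _ => I) e x := rfl

/-- A singular cube is degenerate if it does not depend on the first coordinate. -/
def IsDeg {k : ℕ} (c : C(Cb k, Y)) : Prop :=
  0 < k ∧ ∀ x y : Cb k, (∀ i : Fin k, (i : ℕ) ≠ 0 → x i = y i) → c x = c y

lemma IsDeg.comp {k : ℕ} {c : C(Cb k, Y)} (h : IsDeg c) (f : C(Y, Z)) : IsDeg (f.comp c) :=
  ⟨h.1, fun x y hxy => congrArg f (h.2 x y hxy)⟩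

lemma IsDeg.face_zero {k : ℕ} {c : C(Cb (k + 1), Y)} (h : IsDeg c) (e e' : I) :
    c.comp (face 0 e) = c.comp (face 0 e') := by
  ext x
  refine h.2 _ _ fun i hi => ?_
  obtain ⟨j, rfl⟩ := Fin.exists_succ_eq.2 (fun h0 : i = 0 => hi (by simp [h0]))
  simp

lemma IsDeg.face_succ {k : ℕ} {c : C(Cb (k + 2), Y)} (h : IsDeg c) (i : Fin (k + 1)) (e : I) :
    IsDeg (c.comp (face i.succ e)) := by
  refine ⟨by omega, fun x y hxy => h.2 _ _ fun j hj => ?_⟩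
  rcases Fin.eq_self_or_eq_succAbove i.succ j with rfl | ⟨l, rfl⟩
  · simp
  · simp only [face_apply, Fin.insertNth_apply_succAbove]
    apply hxy
    rintro h0
    apply hj
    have : l = 0 := Fin.ext h0
    subst this
    simp

/-- Normalized singular cubical chains. -/
abbrev N (k : ℕ) (Y : Type*) [TopologicalSpace Y] := {c : C(Cb k, Y) // ¬ IsDeg c} →₀ ℤ

open Classical in
/-- The chain of a singular cube, zero if the cube is degenerate. -/
def cls {k : ℕ} (c : C(Cb k, Y)) : N k Y :=
  if h : IsDeg c then 0 else Finsupp.single ⟨c, h⟩ 1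

lemma cls_of_isDeg {k : ℕ} {c : C(Cb k, Y)} (h : IsDeg c) : cls c = 0 := dif_pos h

lemma cls_val {k : ℕ} (c : {c : C(Cb k, Y) // ¬ IsDeg c}) : cls c.1 = Finsupp.single c 1 :=
  dif_neg c.2

/-- The linear extension of a function on singular cubes. -/
def lift {M : Type*} [AddCommGroup M] {k : ℕ} (ψ : C(Cb k, Y) → M) : N k Y →ₗ[ℤ] M :=
  Finsupp.linearCombination ℤ fun c => ψ c.1

lemma lift_cls {M : Type*} [AddCommGroup M] {k : ℕ} {ψ : C(Cb k, Y) → M}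
    (hψ : ∀ c, IsDeg c → ψ c = 0) (c : C(Cb k, Y)) : lift ψ (cls c) = ψ c := by
  by_cases h : IsDeg c
  · rw [cls_of_isDeg h, map_zero, hψ c h]
  · rw [cls, dif_neg h, lift, Finsupp.linearCombination_single, one_smul]

lemma hom_ext {M : Type*} [AddCommGroup M] {k : ℕ} {f g : N k Y →ₗ[ℤ] M}
    (h : ∀ c, f (cls c) = g (cls c)) : f = g := by
  refine Finsupp.lhom_ext' fun c => LinearMap.ext_ring ?_
  simpa [cls_val] using h c.1

/-- Pushforward of chains. -/
def map {k : ℕ} (f : C(Y, Z)) : N k Y →ₗ[ℤ] N k Z := lift fun c => cls (f.comp c)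

@[simp] lemma map_cls {k : ℕ} (f : C(Y, Z)) (c : C(Cb k, Y)) :
    map f (cls c) = cls (f.comp c) :=
  lift_cls (fun _ h => cls_of_isDeg (h.comp f)) c

lemma map_map {k : ℕ} (g : C(Y, Z)) (f : C(X, Y)) (z : N k X) :
    map g (map f z) = map (g.comp f) z := by
  have : (map g).comp (map f) = map (k := k) (g.comp f) := hom_ext fun c => by
    simp [ContinuousMap.comp_assoc]
  exact LinearMap.congr_fun this z

/-- The boundary of a cube, as a chain. -/
def bdCube {k : ℕ} (c : C(Cb (k + 1), Y)) : N k Y :=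
  ∑ i : Fin (k + 1), (-1 : ℤ) ^ (i : ℕ) •
    (cls (c.comp (face i 1)) - cls (c.comp (face i 0)))

lemma bdCube_of_isDeg {k : ℕ} {c : C(Cb (k + 1), Y)} (h : IsDeg c) : bdCube c = 0 := by
  refine Finset.sum_eq_zero fun i _ => ?_
  refine Fin.cases ?_ (fun j => ?_) i
  · rw [h.face_zero 1 0, sub_self, smul_zero]
  · cases k with
    | zero => exact j.elim0
    | succ k =>
      rw [cls_of_isDeg (h.face_succ _ _), cls_of_isDeg (h.face_succ _ _), sub_self, smul_zero]

/-- The boundary operator. -/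
def bd {k : ℕ} : N (k + 1) Y →ₗ[ℤ] N k Y := lift bdCube

@[simp] lemma bd_cls {k : ℕ} (c : C(Cb (k + 1), Y)) : bd (cls c) = bdCube c :=
  lift_cls (fun _ => bdCube_of_isDeg) c

lemma bd_map {k : ℕ} (f : C(Y, Z)) (z : N (k + 1) Y) : bd (map f z) = map f (bd z) := by
  have : bd.comp (map f) = (map f).comp (bd (k := k)) := hom_ext fun c => by
    simp [bdCube, map_sum, ContinuousMap.comp_assoc]
  exact LinearMap.congr_fun this z

lemma face_comp_face {k : ℕ} (i : Fin (k + 2)) (j : Fin (k + 1)) (e e' : I) :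
    (face (i.succAbove j) e').comp (face (j.predAbove i) e) = (face i e).comp (face j e') := by
  ext1 x
  funext l
  simp only [ContinuousMap.comp_apply, face_apply]
  rcases Fin.eq_self_or_eq_succAbove i l with rfl | ⟨l, rfl⟩
  · have h := Fin.succAbove_succAbove_predAbove l j
    generalize l.succAbove j = a at h ⊢
    generalize j.predAbove l = b at h ⊢
    subst h
    simp
  · rcases Fin.eq_self_or_eq_succAbove j l with rfl | ⟨l, rfl⟩
    · simp
    · rw [Fin.insertNth_apply_succAbove, Fin.insertNth_apply_succAbove,
        ← Fin.succAbove_succAbove_succAbove_predAbove i j l, Fin.insertNth_apply_succAbove,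
        Fin.insertNth_apply_succAbove]

lemma bd_bd {k : ℕ} (z : N (k + 2) Y) : bd (bd z) = 0 := by
  have : bd.comp bd = (0 : N (k + 2) Y →ₗ[ℤ] N k Y) := hom_ext fun c => by
    simp only [LinearMap.comp_apply, bd_cls, LinearMap.zero_apply]
    let t : Fin (k + 2) × Fin (k + 1) → I → I → N k Y := fun p e e' =>
      cls ((c.comp (face p.1 e)).comp (face p.2 e'))
    let s : Fin (k + 2) × Fin (k + 1) → N k Y := fun p =>
      (-1 : ℤ) ^ ((p.1 : ℕ) + (p.2 : ℕ)) • ((t p 1 1 - t p 1 0) - (t p 0 1 - t p 0 0))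
    have h1 : bd (bdCube c) = ∑ p, s p := by
      rw [Fintype.sum_prod_type, bdCube, map_sum]
      refine Finset.sum_congr rfl fun i _ => ?_
      rw [map_smul, map_sub, bd_cls, bd_cls, bdCube, bdCube, ← Finset.sum_sub_distrib,
        Finset.smul_sum]
      refine Finset.sum_congr rfl fun j _ => ?_
      simp only [s, t]
      rw [← smul_sub, smul_smul, pow_add]
    rw [h1]
    have hinv : ∀ p : Fin (k + 2) × Fin (k + 1),
        s (p.1.succAbove p.2, p.2.predAbove p.1) = - s p := by
      rintro ⟨i, j⟩
      have ht : ∀ e e', t (i.succAbove j, j.predAbove i) e' e = t (i, j) e e' := fun e e' => by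
        simp only [t, ContinuousMap.comp_assoc]
        rw [face_comp_face]
      simp only [s, ht, Fin.neg_one_pow_succAbove_add_predAbove, neg_smul]
      congr 2
      abel
    refine Finset.sum_involution (fun p _ => (p.1.succAbove p.2, p.2.predAbove p.1))
      (fun p _ => ?_) (fun p _ _ h => ?_) (fun _ _ => Finset.mem_univ _) (fun p _ => ?_)
    · rw [hinv]; exact add_neg_cancel _
    · exact Fin.succAbove_ne _ _ (congrArg Prod.fst h)
    · ext1
      · exact Fin.succAbove_succAbove_predAbove _ _
      · exact Fin.predAbove_predAbove_succAbove _ _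
  exact LinearMap.congr_fun this z

/-- The cube swept out by a singular cube under a homotopy; the time coordinate is last. -/
def cylCube {k : ℕ} (Φ : C(Y × I, Z)) (c : C(Cb k, Y)) : C(Cb (k + 1), Z) :=
  ⟨fun x => Φ (c (Fin.init x), x (Fin.last k)), by
    have : Continuous fun x : Cb (k + 1) => (Fin.init x : Cb k) :=
      continuous_pi fun i => continuous_apply _
    fun_prop⟩

lemma cylCube_of_isDeg {k : ℕ} (Φ : C(Y × I, Z)) {c : C(Cb k, Y)} (h : IsDeg c) :
    IsDeg (cylCube Φ c) := by
  refine ⟨by omega, fun x y hxy => ?_⟩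
  simp only [cylCube, ContinuousMap.coe_mk]
  rw [hxy (Fin.last k) (by simpa using h.1.ne'), h.2 (Fin.init x) (Fin.init y)
    fun i hi => hxy i.castSucc (by simpa using hi)]

/-- The cylinder operator of a homotopy. -/
def cyl {k : ℕ} (Φ : C(Y × I, Z)) : N k Y →ₗ[ℤ] N (k + 1) Z := lift fun c => cls (cylCube Φ c)

@[simp] lemma cyl_cls {k : ℕ} (Φ : C(Y × I, Z)) (c : C(Cb k, Y)) :
    cyl Φ (cls c) = cls (cylCube Φ c) :=
  lift_cls (fun _ h => cls_of_isDeg (cylCube_of_isDeg Φ h)) c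

/-- A time slice of a homotopy. -/
def slice (Φ : C(Y × I, Z)) (t : I) : C(Y, Z) := ⟨fun y => Φ (y, t), by fun_prop⟩

lemma cylCube_face_last {k : ℕ} (Φ : C(Y × I, Z)) (c : C(Cb k, Y)) (e : I) :
    (cylCube Φ c).comp (face (Fin.last k) e) = (slice Φ e).comp c := by
  ext x
  simp [cylCube, slice, Fin.insertNth_last']

lemma cylCube_face_castSucc {k : ℕ} (Φ : C(Y × I, Z)) (c : C(Cb (k + 1), Y))
    (i : Fin (k + 1)) (e : I) :
    (cylCube Φ c).comp (face i.castSucc e) = cylCube Φ (c.comp (face i e)) := by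
  ext x
  simp only [cylCube, ContinuousMap.comp_apply, ContinuousMap.coe_mk, face_apply]
  congr 2
  · congr 1
    funext l
    simp only [Fin.init]
    rcases Fin.eq_self_or_eq_succAbove i l with rfl | ⟨l, rfl⟩
    · simp
    · rw [← Fin.castSucc_succAbove_castSucc, Fin.insertNth_apply_succAbove,
        Fin.insertNth_apply_succAbove, Fin.init]
  · have : Fin.last (k + 1) = i.castSucc.succAbove (Fin.last k) := by
      simp
    rw [this, Fin.insertNth_apply_succAbove]

lemma bd_cyl {k : ℕ} (Φ : C(Y × I, Z)) (z : N (k + 1) Y) :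
    bd (cyl Φ z) = cyl Φ (bd z) +
      (-1 : ℤ) ^ (k + 1) • (map (slice Φ 1) z - map (slice Φ 0) z) := by
  have : bd.comp (cyl Φ) = (cyl Φ).comp bd +
      (-1 : ℤ) ^ (k + 1) • (map (k := k + 1) (slice Φ 1) - map (slice Φ 0)) :=
    hom_ext fun c => by
      simp only [LinearMap.comp_apply, cyl_cls, bd_cls, LinearMap.add_apply, LinearMap.smul_apply,
        LinearMap.sub_apply, map_cls, bdCube]
      rw [Fin.sum_univ_castSucc]
      simp [cylCube_face_last, cylCube_face_castSucc, map_sum]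
  exact LinearMap.congr_fun this z

lemma map_cyl {W : Type*} [TopologicalSpace W] {k : ℕ} (Φ : C(Y × I, Z)) (f : C(Z, W))
    (z : N k Y) : map f (cyl Φ z) = cyl (f.comp Φ) z := by
  have : (map f).comp (cyl Φ) = cyl (k := k) (f.comp Φ) := hom_ext fun c => by
    simp only [LinearMap.comp_apply, cyl_cls, map_cls]; rfl
  exact LinearMap.congr_fun this z

lemma cyl_map {k : ℕ} (f : C(X, Y)) (Φ : C(Y × I, Z)) (z : N k X) :
    cyl Φ (map f z) = cyl (Φ.comp (f.prodMap (ContinuousMap.id I))) z := by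
  have : (cyl Φ).comp (map f) = cyl (k := k) (Φ.comp (f.prodMap (ContinuousMap.id I))) :=
    hom_ext fun c => by
      simp only [LinearMap.comp_apply, cyl_cls, map_cls]; rfl
  exact LinearMap.congr_fun this z

lemma map_of_const {k : ℕ} {f : C(Y, Z)} (hf : ∀ y y', f y = f y') (z : N (k + 1) Y) :
    map f z = 0 := by
  have : map f = (0 : N (k + 1) Y →ₗ[ℤ] N (k + 1) Z) := hom_ext fun c => by
    rw [map_cls, cls_of_isDeg ⟨by omega, fun x y _ => hf _ _⟩, LinearMap.zero_apply]
  exact LinearMap.congr_fun this z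

/-- The affine maps of the interval onto its two halves. -/
def halfI (b : Bool) : C(I, I) :=
  ⟨fun x => ⟨((x : ℝ) + if b then 1 else 0) / 2, by
    cases b <;> simp only [Bool.false_eq_true, if_true, if_false] <;> constructor <;>
      linarith [x.2.1, x.2.2]⟩, by fun_prop⟩

lemma halfI_apply (b : Bool) (x : I) :
    ((halfI b x : I) : ℝ) = ((x : ℝ) + if b then 1 else 0) / 2 := rfl

lemma halfI_false_zero : halfI false 0 = 0 := Subtype.ext (by simp [halfI_apply])
lemma halfI_true_one : halfI true 1 = 1 := Subtype.ext (by simp [halfI_apply])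
lemma halfI_false_one : halfI false 1 = halfI true 0 := Subtype.ext (by simp [halfI_apply])

/-- The affine maps of the cube onto its dyadic subcubes. -/
def half {k : ℕ} (b : Fin k → Bool) : C(Cb k, Cb k) :=
  ⟨fun x i => halfI (b i) (x i), by fun_prop⟩

lemma half_face {k : ℕ} (b : Fin k → Bool) (b₀ : Bool) (i : Fin (k + 1)) (e : I) :
    (half (i.insertNth (α := fun _ => Bool) b₀ b)).comp (face i e) =
      (face i (halfI b₀ e)).comp (half b) := by
  ext1 x
  funext l
  rcases Fin.eq_self_or_eq_succAbove i l with rfl | ⟨l, rfl⟩ <;> simp [half]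

lemma dist_half_le {k : ℕ} (b : Fin k → Bool) (x y : Cb k) :
    dist (half b x) (half b y) ≤ dist x y / 2 := by
  refine (dist_pi_le_iff (by positivity)).2 fun i => ?_
  have h := dist_le_pi_dist x y i
  rw [Subtype.dist_eq, Real.dist_eq] at h ⊢
  simp only [half, ContinuousMap.coe_mk, halfI_apply]
  rw [← sub_div, add_sub_add_right_eq_sub, abs_div, abs_two]
  linarith

/-- The subdivision of a singular cube. -/
def sdCube {k : ℕ} (c : C(Cb k, Y)) : N k Y := ∑ b : Fin k → Bool, cls (c.comp (half b))

lemma IsDeg.half {k : ℕ} {c : C(Cb k, Y)} (h : IsDeg c) (b : Fin k → Bool) :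
    IsDeg (c.comp (half b)) :=
  ⟨h.1, fun _ _ hxy => h.2 _ _ fun i hi => congrArg (halfI (b i)) (hxy i hi)⟩

/-- The subdivision operator. -/
def sd {k : ℕ} : N k Y →ₗ[ℤ] N k Y := lift sdCube

lemma sdCube_of_isDeg {k : ℕ} {c : C(Cb k, Y)} (h : IsDeg c) : sdCube c = 0 :=
  Finset.sum_eq_zero fun b _ => cls_of_isDeg (h.half b)

@[simp] lemma sd_cls {k : ℕ} (c : C(Cb k, Y)) : sd (cls c) = sdCube c :=
  lift_cls (fun _ => sdCube_of_isDeg) c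

lemma sd_map {k : ℕ} (f : C(Y, Z)) (z : N k Y) : sd (map f z) = map f (sd z) := by
  have : sd.comp (map f) = (map f).comp (sd (k := k)) := hom_ext fun c => by
    simp [sdCube, map_sum, ContinuousMap.comp_assoc]
  exact LinearMap.congr_fun this z

lemma bd_sd {k : ℕ} (z : N (k + 1) Y) : bd (sd z) = sd (bd z) := by
  have : bd.comp sd = sd.comp (bd (k := k) (Y := Y)) := hom_ext fun c => by
    have h1 : ∀ i : Fin (k + 1), ∑ b : Fin (k + 1) → Bool,
        (cls ((c.comp (half b)).comp (face i 1)) - cls ((c.comp (half b)).comp (face i 0))) =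
        sdCube (c.comp (face i 1)) - sdCube (c.comp (face i 0)) := fun i => by
      rw [← (Fin.insertNthEquiv (fun _ => Bool) i).sum_comp, Fintype.sum_prod_type,
        Fintype.sum_bool, sdCube, sdCube, ← Finset.sum_add_distrib, ← Finset.sum_sub_distrib]
      refine Finset.sum_congr rfl fun b _ => ?_
      have hE : ∀ b₀, Fin.insertNthEquiv (fun _ => Bool) i (b₀, b) = i.insertNth b₀ b :=
        fun _ => rfl
      simp only [hE, ContinuousMap.comp_assoc, half_face, halfI_true_one,
        halfI_false_zero, halfI_false_one]
      abel
    simp only [LinearMap.comp_apply, sd_cls, bd_cls, sdCube, map_sum]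
    simp only [bdCube, map_sum, map_smul, map_sub, sd_cls]
    rw [Finset.sum_comm]
    refine Finset.sum_congr rfl fun i _ => ?_
    rw [← Finset.smul_sum, h1]
  exact LinearMap.congr_fun this z

/-- The linear contraction of the cube to the origin. -/
def contr (k : ℕ) : C(Cb k × I, Cb k) := ⟨fun p i => σ p.2 * p.1 i, by fun_prop⟩

/-- The identity cube. -/
def iota (k : ℕ) : C(Cb k, Cb k) := ContinuousMap.id _

/-- The universal chains of the chain homotopy between subdivision and the identity. -/
def tau : (k : ℕ) → N (k + 1) (Cb k)
  | 0 => 0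
  | k + 1 => (-1 : ℤ) ^ k • cyl (contr (k + 1)) (sd (cls (iota (k + 1))) - cls (iota (k + 1)) -
      ∑ i : Fin (k + 1), (-1 : ℤ) ^ (i : ℕ) •
        (map (face i 1) (tau k) - map (face i 0) (tau k)))

/-- The projection of the cube forgetting the first coordinate. -/
def prTail (k : ℕ) : C(Cb (k + 1), Cb k) :=
  ⟨fun x => Fin.tail x, continuous_pi fun _ => continuous_apply _⟩

lemma isDeg_prTail (k : ℕ) : IsDeg (prTail k) :=
  ⟨by omega, fun _ _ h => funext fun i => h i.succ (by simp)⟩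

lemma IsDeg.eq_comp {k : ℕ} {c : C(Cb (k + 1), Y)} (h : IsDeg c) (e : I) :
    c = (c.comp (face 0 e)).comp (prTail k) := by
  ext x
  refine h.2 _ _ fun i hi => ?_
  obtain ⟨j, rfl⟩ := Fin.exists_succ_eq.2 (fun h0 : i = 0 => hi (by simp [h0]))
  simp [prTail, Fin.tail]

lemma map_tau_of_isDeg (k : ℕ) : ∀ {Y : Type} [TopologicalSpace Y] {c : C(Cb k, Y)},
    IsDeg c → map c (tau k) = 0 := by
  induction k with
  | zero => exact fun h => absurd h.1 (lt_irrefl _)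
  | succ k ih =>
    intro Y _ c h
    rw [h.eq_comp 0, ← map_map]
    suffices hp : map (prTail k) (tau (k + 1)) = 0 by rw [hp, map_zero]
    have hc : (prTail k).comp (contr (k + 1)) =
        (contr k).comp ((prTail k).prodMap (ContinuousMap.id I)) := rfl
    rw [tau, map_smul, map_cyl, hc, ← cyl_map]
    have h0 : map (prTail k) (sd (cls (iota (k + 1))) - cls (iota (k + 1)) -
      ∑ i : Fin (k + 1), (-1 : ℤ) ^ (i : ℕ) •
        (map (face i 1) (tau k) - map (face i 0) (tau k))) = 0 := by
      have hi : cls ((prTail k).comp (iota (k + 1))) = 0 := cls_of_isDeg (isDeg_prTail k)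
      rw [map_sub, map_sub, ← sd_map, map_cls, hi, map_zero, sub_zero, zero_sub, neg_eq_zero,
        map_sum]
      refine Finset.sum_eq_zero fun i _ => ?_
      rw [map_smul, map_sub, map_map, map_map]
      refine Fin.cases ?_ (fun j => ?_) i
      · rw [(isDeg_prTail k).face_zero 1 0, sub_self, smul_zero]
      · cases k with
        | zero => exact j.elim0
        | succ k =>
          rw [ih ((isDeg_prTail _).face_succ _ _), ih ((isDeg_prTail _).face_succ _ _), sub_self,
            smul_zero]
    rw [h0, map_zero, smul_zero]

/-- The chain homotopy between subdivision and the identity. -/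
def T {k : ℕ} {Y : Type} [TopologicalSpace Y] : N k Y →ₗ[ℤ] N (k + 1) Y :=
  lift fun c => map c (tau k)

section

variable {Y Z : Type} [TopologicalSpace Y] [TopologicalSpace Z] {k : ℕ}

@[simp] lemma T_cls (c : C(Cb k, Y)) : T (cls c) = map c (tau k) :=
  lift_cls (fun _ => map_tau_of_isDeg k) c

lemma T_map (f : C(Y, Z)) (z : N k Y) : T (map f z) = map f (T z) := by
  have : T.comp (map f) = (map f).comp (T (k := k)) := hom_ext fun c => by
    simp [map_map]
  exact LinearMap.congr_fun this z

lemma T_bd_iota : T (bd (cls (iota (k + 1)))) = ∑ i : Fin (k + 1), (-1 : ℤ) ^ (i : ℕ) •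
        (map (face i 1) (tau k) - map (face i 0) (tau k)) := by
  simp only [bd_cls, bdCube, map_sum, map_smul, map_sub, T_cls]
  rfl

lemma map_id' (z : N k Y) : map (ContinuousMap.id Y) z = z := by
  have : map (ContinuousMap.id Y) = (LinearMap.id : N k Y →ₗ[ℤ] N k Y) := hom_ext fun c => by
    simp
  exact LinearMap.congr_fun this z

lemma sd_zero_dim (z : N 0 Y) : sd z = z := by
  have : sd = (LinearMap.id : N 0 Y →ₗ[ℤ] N 0 Y) := hom_ext fun c => by
    rw [sd_cls, sdCube, Fintype.sum_unique, LinearMap.id_apply]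
    congr 1
    ext x
    exact congrArg c (Subsingleton.elim _ _)
  exact LinearMap.congr_fun this z

lemma T_zero_dim (z : N 0 Y) : T z = 0 := by
  have : T = (0 : N 0 Y →ₗ[ℤ] N 1 Y) := hom_ext fun c => by simp [tau]
  exact LinearMap.congr_fun this z

lemma tau_succ : tau (k + 1) = (-1 : ℤ) ^ k • cyl (contr (k + 1)) (sd (cls (iota (k + 1))) -
    cls (iota (k + 1)) - T (bd (cls (iota (k + 1))))) := by
  rw [T_bd_iota, tau]

lemma bd_tau_of_bd_eq_zero (h : bd (sd (cls (iota (k + 1))) -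
    cls (iota (k + 1)) - T (bd (cls (iota (k + 1))))) = 0) :
    bd (tau (k + 1)) = sd (cls (iota (k + 1))) -
    cls (iota (k + 1)) - T (bd (cls (iota (k + 1)))) := by
  have h0 : slice (contr (k + 1)) 0 = ContinuousMap.id _ := by
    ext x i; simp [slice, contr]
  have h1 : ∀ y y', slice (contr (k + 1)) 1 y = slice (contr (k + 1)) 1 y' := fun y y' => by
    ext i; simp [slice, contr]
  rw [tau_succ, map_smul, bd_cyl, h, map_zero, zero_add, h0, map_of_const h1, map_id', zero_sub,
    smul_smul, ← pow_add, smul_neg, ← neg_smul, ← neg_one_mul, ← pow_succ']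
  rw [show k + (k + 1) + 1 = 2 * (k + 1) by ring, pow_mul, neg_one_sq, one_pow, one_smul]

lemma bd_T_of_bd_tau (h : bd (tau (k + 1)) = sd (cls (iota (k + 1))) -
    cls (iota (k + 1)) - T (bd (cls (iota (k + 1))))) (z : N (k + 1) Y) :
    bd (T z) = sd z - z - T (bd z) := by
  have : bd.comp T = sd - LinearMap.id - T.comp (bd (k := k) (Y := Y)) := hom_ext fun c => by
    have hc : cls c = map c (cls (iota (k + 1))) := by
      rw [map_cls]; rfl
    simp only [LinearMap.comp_apply, LinearMap.sub_apply, LinearMap.id_apply, T_cls]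
    rw [bd_map, h, map_sub, map_sub, ← sd_map, ← T_map, ← bd_map, ← hc]
  exact LinearMap.congr_fun this z

lemma bd_tau : ∀ k : ℕ, bd (tau (k + 1)) = sd (cls (iota (k + 1))) -
    cls (iota (k + 1)) - T (bd (cls (iota (k + 1))))
  | 0 => bd_tau_of_bd_eq_zero (by
      rw [map_sub, map_sub, bd_sd, sd_zero_dim, sub_self, T_zero_dim, map_zero, sub_zero])
  | k + 1 => bd_tau_of_bd_eq_zero (by
      rw [map_sub, map_sub, bd_sd, bd_T_of_bd_tau (bd_tau k), bd_bd, map_zero, sub_zero, sub_self])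

lemma bd_T (z : N (k + 1) Y) : bd (T z) = sd z - z - T (bd z) := bd_T_of_bd_tau (bd_tau k) z

end

section

variable {Y Z : Type} [TopologicalSpace Y] [TopologicalSpace Z] {k : ℕ}

/-- The chains supported in a subset. -/
def NA (k : ℕ) (A : Set Y) : Submodule ℤ (N k Y) :=
  Finsupp.supported ℤ ℤ {c | range c.1 ⊆ A}

lemma cls_mem_NA {A : Set Y} {c : C(Cb k, Y)} (h : ∀ x, c x ∈ A) : cls c ∈ NA k A := by
  by_cases hc : IsDeg c
  · rw [cls_of_isDeg hc]; exact zero_mem _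
  · rw [cls, dif_neg hc]
    exact Finsupp.single_mem_supported _ _ (range_subset_iff.2 h)

lemma NA_le {A : Set Y} {P : Submodule ℤ (N k Y)}
    (h : ∀ c : C(Cb k, Y), (∀ x, c x ∈ A) → cls c ∈ P) : NA k A ≤ P := by
  rw [NA, Finsupp.supported_eq_span_single, Submodule.span_le]
  rintro _ ⟨c, hc, rfl⟩
  simp only [← cls_val, SetLike.mem_coe]
  exact h _ fun x => hc (mem_range_self x)

lemma NA_mono {A B : Set Y} (h : A ⊆ B) : NA k A ≤ NA k B :=
  NA_le fun _ hc => cls_mem_NA fun x => h (hc x)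

lemma mem_NA_inter {A B : Set Y} {z : N k Y} (hA : z ∈ NA k A) (hB : z ∈ NA k B) :
    z ∈ NA k (A ∩ B) := by
  have h : NA k (A ∩ B) = NA k A ⊓ NA k B := by
    rw [NA, NA, NA, ← Finsupp.supported_inter]
    congr 1
    ext c
    simp [subset_inter_iff]
  rw [h]
  exact ⟨hA, hB⟩

lemma mem_NA_univ (z : N k Y) : z ∈ NA k (univ : Set Y) := by
  simp [NA]

lemma map_mem_NA {A : Set Y} {B : Set Z} {f : C(Y, Z)} (hf : ∀ x ∈ A, f x ∈ B) {z : N k Y}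
    (hz : z ∈ NA k A) : map f z ∈ NA k B := by
  have : NA k A ≤ (NA k B).comap (map f) := NA_le fun c hc => by
    rw [Submodule.mem_comap, map_cls]
    exact cls_mem_NA fun x => hf _ (hc x)
  exact this hz

lemma bd_mem_NA {A : Set Y} {z : N (k + 1) Y} (hz : z ∈ NA (k + 1) A) : bd z ∈ NA k A := by
  have : NA (k + 1) A ≤ (NA k A).comap bd := NA_le fun c hc => by
    rw [Submodule.mem_comap, bd_cls]
    exact sum_mem fun i _ => Submodule.smul_mem _ _ (sub_mem (cls_mem_NA fun x => hc _)
      (cls_mem_NA fun x => hc _))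
  exact this hz

lemma cyl_mem_NA {A : Set Y} {B : Set Z} {Φ : C(Y × I, Z)} (hf : ∀ x ∈ A, ∀ t, Φ (x, t) ∈ B)
    {z : N k Y} (hz : z ∈ NA k A) : cyl Φ z ∈ NA (k + 1) B := by
  have : NA k A ≤ (NA (k + 1) B).comap (cyl Φ) := NA_le fun c hc => by
    rw [Submodule.mem_comap, cyl_cls]
    exact cls_mem_NA fun x => hf _ (hc _) _
  exact this hz

lemma sd_mem_NA {A : Set Y} {z : N k Y} (hz : z ∈ NA k A) : sd z ∈ NA k A := by
  have : NA k A ≤ (NA k A).comap sd := NA_le fun c hc => by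
    rw [Submodule.mem_comap, sd_cls]
    exact sum_mem fun i _ => cls_mem_NA fun x => hc _
  exact this hz

lemma T_mem_NA {A : Set Y} {z : N k Y} (hz : z ∈ NA k A) : T z ∈ NA (k + 1) A := by
  have : NA k A ≤ (NA (k + 1) A).comap T := NA_le fun c hc => by
    rw [Submodule.mem_comap, T_cls]
    exact map_mem_NA (fun x _ => hc x) (mem_NA_univ _)
  exact this hz

lemma sd_pow_mem_NA {A : Set Y} {z : N k Y} (hz : z ∈ NA k A) (m : ℕ) :
    (sd ^ m) z ∈ NA k A := by
  induction m with
  | zero => simpa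
  | succ m ih => rw [pow_succ', Module.End.mul_apply]; exact sd_mem_NA ih

lemma bd_sd_pow (m : ℕ) (z : N (k + 1) Y) : bd ((sd ^ m) z) = (sd ^ m) (bd z) := by
  induction m with
  | zero => simp
  | succ m ih => rw [pow_succ', Module.End.mul_apply, bd_sd, ih, pow_succ', Module.End.mul_apply]

/-- The chain homotopy between iterated subdivision and the identity. -/
def Tit (m : ℕ) : N k Y →ₗ[ℤ] N (k + 1) Y := ∑ j ∈ Finset.range m, T ∘ₗ (sd ^ j)

lemma Tit_mem_NA {A : Set Y} {z : N k Y} (hz : z ∈ NA k A) (m : ℕ) : Tit m z ∈ NA (k + 1) A := by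
  rw [Tit, LinearMap.sum_apply]
  exact sum_mem fun j _ => T_mem_NA (sd_pow_mem_NA hz j)

lemma bd_Tit (m : ℕ) (z : N (k + 1) Y) : bd (Tit m z) = (sd ^ m) z - z - Tit m (bd z) := by
  induction m with
  | zero => simp [Tit]
  | succ m ih =>
    have h : ∀ {l : ℕ} (y : N l Y), Tit (m + 1) y = Tit m y + T ((sd ^ m) y) := fun y => by
      simp [Tit, Finset.sum_range_succ]
    rw [h, h, map_add, ih, bd_T, bd_sd_pow, pow_succ', Module.End.mul_apply]
    abel

lemma sd_pow_cls_mem (c : C(Cb k, Y)) (m : ℕ) : (sd ^ m) (cls c) ∈ Submodule.span ℤ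
    {z | ∃ g : C(Cb k, Cb k), (∀ x y, dist (g x) (g y) ≤ dist x y / 2 ^ m) ∧
      cls (c.comp g) = z} := by
  induction m with
  | zero => exact Submodule.subset_span ⟨ContinuousMap.id _, by simp, by simp⟩
  | succ m ih =>
    rw [pow_succ' sd, Module.End.mul_apply]
    rw [← Submodule.mem_comap]
    refine Submodule.span_le.2 ?_ ih
    rintro _ ⟨g, hg, rfl⟩
    rw [SetLike.mem_coe, Submodule.mem_comap, sd_cls]
    refine sum_mem fun b _ => Submodule.subset_span ⟨g.comp (half b), fun x y => ?_, ?_⟩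
    · refine (hg _ _).trans ?_
      rw [pow_succ', ← div_div]
      gcongr
      exact dist_half_le b x y
    · rw [ContinuousMap.comp_assoc]

lemma exists_sd_pow_mem_sup {A B : Set Y} (hA : IsOpen A) (hB : IsOpen B) {z : N k Y}
    (hz : z ∈ NA k (A ∪ B)) : ∃ m : ℕ, (sd ^ m) z ∈ NA k A ⊔ NA k B := by
  have hsup : ∀ {y : N k Y}, y ∈ NA k A ⊔ NA k B → ∀ m : ℕ, (sd ^ m) y ∈ NA k A ⊔ NA k B := by
    intro y hy m
    obtain ⟨a, ha, b, hb, rfl⟩ := Submodule.mem_sup.1 hy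
    rw [map_add]
    exact Submodule.add_mem_sup (sd_pow_mem_NA ha m) (sd_pow_mem_NA hb m)
  let P : Submodule ℤ (N k Y) :=
    { carrier := {z | ∃ m : ℕ, (sd ^ m) z ∈ NA k A ⊔ NA k B}
      zero_mem' := ⟨0, by simp⟩
      add_mem' := by
        rintro x y ⟨m, hm⟩ ⟨l, hl⟩
        refine ⟨m + l, ?_⟩
        rw [map_add, add_comm m l, pow_add, Module.End.mul_apply, ← pow_add, add_comm l m, pow_add,
          Module.End.mul_apply]
        exact add_mem (hsup hm l) (hsup hl m)
      smul_mem' := by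
        rintro r x ⟨m, hm⟩
        exact ⟨m, by rw [map_smul]; exact Submodule.smul_mem _ _ hm⟩ }
  have hP : NA k (A ∪ B) ≤ P := NA_le fun c hc => by
    obtain ⟨δ, hδ, h⟩ := lebesgue_number_lemma_of_metric (s := (univ : Set (Cb k)))
      (c := fun b : Bool => c ⁻¹' (if b then A else B)) isCompact_univ
      (fun b => by cases b <;> simpa using IsOpen.preimage c.continuous ‹_›)
      (fun x _ => by
        rcases hc x with h | h
        · exact mem_iUnion.2 ⟨true, by simpa using h⟩
        · exact mem_iUnion.2 ⟨false, by simpa using h⟩)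
    obtain ⟨m, hm⟩ := exists_pow_lt_of_lt_one hδ (show (1 / 2 : ℝ) < 1 by norm_num)
    refine ⟨m, Submodule.span_le.2 ?_ (sd_pow_cls_mem c m)⟩
    rintro _ ⟨g, hg, rfl⟩
    obtain ⟨b, hb⟩ := h (g 0) (mem_univ _)
    have hgb : ∀ x, c (g x) ∈ if b then A else B := fun x => hb (by
      rw [mem_ball]
      refine (hg x 0).trans_lt (lt_of_le_of_lt ?_ hm)
      rw [one_div, inv_pow, ← one_div]
      gcongr
      refine (dist_pi_le_iff zero_le_one).2 fun i => ?_
      rw [Subtype.dist_eq, Real.dist_eq, Pi.zero_apply, Icc.coe_zero, sub_zero,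
        abs_of_nonneg (x i).2.1]
      exact (x i).2.2)
    cases b
    · exact Submodule.mem_sup_right (cls_mem_NA (by simpa using hgb))
    · exact Submodule.mem_sup_left (cls_mem_NA (by simpa using hgb))
  exact hP hz

/-- The homology of a subset vanishes in dimension `k + 1`. -/
def Van (k : ℕ) (A : Set Y) : Prop :=
  ∀ z ∈ NA (k + 1) A, bd z = 0 → ∃ w ∈ NA (k + 2) A, bd w = z

lemma Van.inter {A B : Set Y} (hA : IsOpen A) (hB : IsOpen B) (hvA : Van k A) (hvB : Van k B)
    (h : Van (k + 1) (A ∪ B)) : Van k (A ∩ B) := by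
  intro z hz hbz
  obtain ⟨a, ha, haz⟩ := hvA z (NA_mono inter_subset_left hz) hbz
  obtain ⟨b, hb, hbz⟩ := hvB z (NA_mono inter_subset_right hz) hbz
  have hab : bd (a - b) = 0 := by rw [map_sub, haz, hbz, sub_self]
  obtain ⟨w, hw, hwab⟩ := h (a - b) (sub_mem (NA_mono subset_union_left ha)
    (NA_mono subset_union_right hb)) hab
  obtain ⟨m, hm⟩ := exists_sd_pow_mem_sup hA hB hw
  obtain ⟨wa, hwa, wb, hwb, hwm⟩ := Submodule.mem_sup.1 hm
  have e : bd wa + bd wb = a - b + bd (Tit m a) - bd (Tit m b) := by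
    have := bd_Tit m (a - b)
    rw [hab, map_zero, sub_zero, map_sub, map_sub] at this
    rw [← map_add, hwm, bd_sd_pow, hwab, add_sub_assoc, this, add_sub_cancel]
  have e' : a + bd (Tit m a) - bd wa = b + bd (Tit m b) + bd wb := by
    rw [← sub_eq_zero] at e ⊢
    rw [← neg_eq_zero, ← e]
    abel
  refine ⟨a + bd (Tit m a) - bd wa, mem_NA_inter ?_ ?_, ?_⟩
  · exact sub_mem (add_mem ha (bd_mem_NA (Tit_mem_NA ha m))) (bd_mem_NA hwa)
  · rw [e']
    exact add_mem (add_mem hb (bd_mem_NA (Tit_mem_NA hb m))) (bd_mem_NA hwb)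
  · rw [map_sub, map_add, bd_bd, bd_bd, haz, add_zero, sub_zero]

lemma Van.union {A B : Set Y} (hA : IsOpen A) (hB : IsOpen B) (hvA : Van k A) (hvB : Van k B)
    (h : ∀ a ∈ NA (k + 1) A, bd a ∈ NA k (A ∩ B) → ∃ w ∈ NA (k + 1) (A ∩ B), bd w = bd a) :
    Van k (A ∪ B) := by
  intro z hz hbz
  obtain ⟨m, hm⟩ := exists_sd_pow_mem_sup hA hB hz
  obtain ⟨a, ha, b, hb, hab⟩ := Submodule.mem_sup.1 hm
  have hb0 : bd a = - bd b := by
    rw [eq_neg_iff_add_eq_zero, ← map_add, hab, bd_sd_pow, hbz, map_zero]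
  obtain ⟨w, hw, hwa⟩ := h a ha (mem_NA_inter (bd_mem_NA ha)
    (by rw [hb0]; exact neg_mem (bd_mem_NA hb)))
  obtain ⟨p, hp, hpa⟩ := hvA (a - w) (sub_mem ha (NA_mono inter_subset_left hw))
    (by rw [map_sub, hwa, sub_self])
  obtain ⟨q, hq, hqb⟩ := hvB (b + w) (add_mem hb (NA_mono inter_subset_right hw))
    (by rw [map_add, hwa, hb0, add_neg_cancel])
  refine ⟨p + q - Tit m z, sub_mem (add_mem (NA_mono subset_union_left hp)
    (NA_mono subset_union_right hq)) (Tit_mem_NA hz m), ?_⟩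
  rw [map_sub, map_add, hpa, hqb, bd_Tit, hbz, map_zero, ← hab]
  abel

lemma Van.union_of_van {A B : Set Y} (hA : IsOpen A) (hB : IsOpen B) (hvA : Van (k + 1) A)
    (hvB : Van (k + 1) B) (h : Van k (A ∩ B)) : Van (k + 1) (A ∪ B) :=
  Van.union hA hB hvA hvB fun a _ h' => h _ h' (bd_bd a)

lemma NA_empty (z : N k Y) (hz : z ∈ NA k (∅ : Set Y)) : z = 0 := by
  have : NA k (∅ : Set Y) ≤ ⊥ := NA_le fun c hc => (hc 0).elim
  exact (Submodule.mem_bot ℤ).1 (this hz)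

lemma Van.union_of_disjoint {A B : Set Y} (hA : IsOpen A) (hB : IsOpen B) (hvA : Van k A)
    (hvB : Van k B) (h : A ∩ B = ∅) : Van k (A ∪ B) :=
  Van.union hA hB hvA hvB fun a _ h' => ⟨0, zero_mem _, by
    rw [h] at h'
    rw [NA_empty _ h', map_zero]⟩

lemma exists_bd_eq_map_slice_sub {A : Set Y} {Φ : C(Y × I, Y)}
    (hΦ : ∀ x ∈ A, ∀ t, Φ (x, t) ∈ A) (h0 : ∀ x, Φ (x, 0) = x) {z : N (k + 1) Y}
    (hz : z ∈ NA (k + 1) A) (hbz : bd z = 0) :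
    ∃ w ∈ NA (k + 2) A, bd w = map (slice Φ 1) z - z := by
  have hs : slice Φ 0 = ContinuousMap.id _ := ContinuousMap.ext h0
  refine ⟨(-1 : ℤ) ^ (k + 1) • cyl Φ z, Submodule.smul_mem _ _ (cyl_mem_NA hΦ hz), ?_⟩
  rw [map_smul, bd_cyl, hbz, map_zero, zero_add, smul_smul, ← mul_pow, hs, map_id']
  norm_num

lemma Van.of_homotopy {A B : Set Y} (hB : Van k B) (hBA : B ⊆ A) {Φ : C(Y × I, Y)}
    (hΦ : ∀ x ∈ A, ∀ t, Φ (x, t) ∈ A) (h0 : ∀ x, Φ (x, 0) = x) (h1 : ∀ x ∈ A, Φ (x, 1) ∈ B) :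
    Van k A := by
  intro z hz hbz
  obtain ⟨w, hw, hwz⟩ := exists_bd_eq_map_slice_sub hΦ h0 hz hbz
  obtain ⟨v, hv, hvz⟩ := hB (map (slice Φ 1) z) (map_mem_NA h1 hz)
    (by rw [bd_map, hbz, map_zero])
  exact ⟨v - w, sub_mem (NA_mono hBA hv) hw, by rw [map_sub, hwz, hvz, sub_sub_cancel]⟩

lemma Van.of_contraction {A : Set Y} {Φ : C(Y × I, Y)} (hΦ : ∀ x ∈ A, ∀ t, Φ (x, t) ∈ A)
    (h0 : ∀ x, Φ (x, 0) = x) (h1 : ∀ x y, Φ (x, 1) = Φ (y, 1)) : Van k A := by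
  intro z hz hbz
  obtain ⟨w, hw, hwz⟩ := exists_bd_eq_map_slice_sub hΦ h0 hz hbz
  refine ⟨-w, neg_mem hw, ?_⟩
  rw [map_neg, hwz, map_of_const h1, zero_sub, neg_neg]

end

section

variable {Y Z : Type} [TopologicalSpace Y] [TopologicalSpace Z] {k : ℕ}

lemma map_injective {f : C(Y, Z)} (hf : Function.Injective f) :
    Function.Injective (map (k := k) f) := by
  have hd : ∀ c : C(Cb k, Y), ¬ IsDeg c → ¬ IsDeg (f.comp c) := fun c hc h =>
    hc ⟨h.1, fun x y hxy => hf (h.2 x y hxy)⟩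
  let j : {c : C(Cb k, Y) // ¬ IsDeg c} → {c : C(Cb k, Z) // ¬ IsDeg c} :=
    fun c => ⟨f.comp c.1, hd _ c.2⟩
  have hj : Function.Injective j := fun c c' h => Subtype.ext <| ContinuousMap.ext fun x =>
    hf (DFunLike.congr_fun (congrArg Subtype.val h) x)
  have h : map f = Finsupp.lmapDomain ℤ ℤ j := hom_ext fun c => by
    by_cases hc : IsDeg c
    · rw [cls_of_isDeg hc, map_zero, map_zero]
    · rw [map_cls, cls, cls, dif_neg hc, dif_neg (hd c hc), Finsupp.lmapDomain_apply,
        Finsupp.mapDomain_single]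
  rw [h]
  exact Finsupp.mapDomain_injective hj

/-- The inclusion of a subset. -/
def incl (A : Set Y) : C(A, Y) := ⟨Subtype.val, continuous_subtype_val⟩

lemma exists_map_incl_eq {A : Set Y} {z : N k Y} (hz : z ∈ NA k A) :
    ∃ z' : N k A, map (incl A) z' = z := by
  have : NA k A ≤ LinearMap.range (map (incl A)) := NA_le fun c hc =>
    ⟨cls ⟨fun x => ⟨c x, hc x⟩, by fun_prop⟩, by rw [map_cls]; rfl⟩
  exact this hz

lemma Van.of_retract {A : Set Y} {B : Set Z} (hB : Van k B) (f : C(A, B)) (g : C(B, A))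
    (hgf : ∀ x, g (f x) = x) : Van k A := by
  have hi : ∀ {l : ℕ}, Function.Injective (map (k := l) (incl A)) := fun {_} =>
    map_injective (f := incl A) Subtype.val_injective
  have hi' : ∀ {l : ℕ}, Function.Injective (map (k := l) (incl B)) := fun {_} =>
    map_injective (f := incl B) Subtype.val_injective
  intro z hz hbz
  obtain ⟨z, rfl⟩ := exists_map_incl_eq hz
  rw [bd_map, map_eq_zero_iff _ hi] at hbz
  obtain ⟨w, hw, hwz⟩ := hB (map (incl B) (map f z))
    (map_mem_NA (fun x _ => x.2) (mem_NA_univ _)) (by rw [bd_map, bd_map, hbz, map_zero, map_zero])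
  obtain ⟨w, rfl⟩ := exists_map_incl_eq hw
  rw [bd_map] at hwz
  refine ⟨map (incl A) (map g w), map_mem_NA (fun x _ => x.2) (mem_NA_univ _), ?_⟩
  have hgf' : g.comp f = ContinuousMap.id A := ContinuousMap.ext hgf
  rw [bd_map, bd_map, hi' hwz, map_map g, hgf', map_id']

lemma Van.of_isClopen {A B : Set Y} (hB : Van k B) (hAB : A ⊆ B) (hA : IsOpen A)
    (hBA : IsOpen (B \ A)) : Van k A := by
  classical
  rcases A.eq_empty_or_nonempty with rfl | ⟨p, hp⟩
  · intro z hz _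
    exact ⟨0, zero_mem _, by rw [NA_empty z hz, map_zero]⟩
  have hcl : IsClopen {x : B | (x : Y) ∈ A} := by
    refine ⟨⟨?_⟩, hA.preimage continuous_subtype_val⟩
    convert hBA.preimage (continuous_subtype_val : Continuous fun x : B => (x : Y)) using 1
    ext x
    simp
  refine hB.of_retract ⟨fun x => ⟨x, hAB x.2⟩, by fun_prop⟩
    ⟨fun x => if h : (x : Y) ∈ A then ⟨x, h⟩ else ⟨p, hp⟩, ?_⟩ fun x => dif_pos x.2
  rw [continuous_induced_rng]
  have : (Subtype.val ∘ fun x : B => if h : (x : Y) ∈ A then (⟨x, h⟩ : A) else ⟨p, hp⟩) =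
      fun x : B => if (x : Y) ∈ A then (x : Y) else p := by
    funext x
    simp only [Function.comp_apply]
    split_ifs <;> rfl
  rw [this]
  refine continuous_if (fun a ha => ?_) continuous_subtype_val.continuousOn continuousOn_const
  rw [hcl.frontier_eq] at ha
  exact ha.elim

end

section

variable {E : Type} [NormedAddCommGroup E] [NormedSpace ℝ E] {k : ℕ}

lemma van_halfSpace (l : E →L[ℝ] ℝ) (u : E) (hu : l u = 1) : Van k {x | 0 < l x} := by
  refine Van.of_contraction (Φ := ⟨fun p => (1 - (p.2 : ℝ)) • p.1 + (p.2 : ℝ) • u, by fun_prop⟩)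
    (fun x hx t => ?_) (fun x => by simp) (fun x y => by simp)
  simp only [mem_ofPred_eq, ContinuousMap.coe_mk, map_add, map_smul, hu, smul_eq_mul, mul_one] at *
  rcases t.2.1.eq_or_lt with h | h
  · rw [← h]; simpa using hx
  · exact add_pos_of_nonneg_of_pos (mul_nonneg (sub_nonneg.2 t.2.2) hx.le) h

lemma van_compl_inter_halfSpace (Z : Set E) (l : E →L[ℝ] ℝ) (u : E) (hu : l u = 1)
    (hZ : ∀ x ∈ Z, ∀ t : ℝ, x + t • u ∈ Z) : Van k (Z ∩ {x | l x ≤ 0})ᶜ := by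
  have hl : Continuous fun x => l x := l.continuous
  refine (van_halfSpace l u hu).of_homotopy (fun x hx h =>
    (not_le.2 (mem_ofPred.1 hx)) (mem_ofPred.1 h.2))
    (Φ := ⟨fun p => p.1 + ((p.2 : ℝ) * (1 + |l p.1|)) • u, by fun_prop⟩)
    (fun x hx t => ?_) (fun x => by simp) (fun x hx => ?_)
  · rintro ⟨h1, h2⟩
    simp only [mem_ofPred_eq, ContinuousMap.coe_mk, map_add, map_smul, hu, smul_eq_mul,
      mul_one] at h1 h2
    refine hx ⟨?_, ?_⟩
    · have := hZ _ h1 (-((t : ℝ) * (1 + |l x|)))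
      rwa [neg_smul, add_neg_cancel_right] at this
    · have : 0 ≤ (t : ℝ) * (1 + |l x|) := mul_nonneg t.2.1 (by positivity)
      simp only [mem_ofPred_eq]
      linarith
  · simp only [mem_ofPred_eq, ContinuousMap.coe_mk, map_add, map_smul, hu, smul_eq_mul,
      mul_one, Icc.coe_one, one_mul]
    linarith [neg_abs_le (l x)]

lemma van_compl_inter_halfSpace' (Z : Set E) (l : E →L[ℝ] ℝ) (u : E) (hu : l u = 1)
    (hZ : ∀ x ∈ Z, ∀ t : ℝ, x + t • u ∈ Z) : Van k (Z ∩ {x | 0 ≤ l x})ᶜ := by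
  have := van_compl_inter_halfSpace (k := k) Z (-l) (-u) (by simp [hu]) fun x hx t => by
    rw [smul_neg, ← neg_smul]
    exact hZ x hx _
  simpa using this

section

variable {Z : Set E} (l : E →L[ℝ] ℝ)

lemma compl_inter_union_compl_inter : (Z ∩ {x | l x ≤ 0})ᶜ ∪ (Z ∩ {x | 0 ≤ l x})ᶜ =
    (Z ∩ {x | l x = 0})ᶜ := by
  rw [← compl_inter, ← inter_inter_distrib_left]
  congr 2
  ext x
  exact (le_antisymm_iff (a := l x)).symm

lemma compl_inter_inter_compl_inter : (Z ∩ {x | l x ≤ 0})ᶜ ∩ (Z ∩ {x | 0 ≤ l x})ᶜ = Zᶜ := by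
  rw [← compl_union, ← inter_union_distrib_left, inter_eq_left.2]
  exact fun x _ => le_total (l x) 0

lemma Van.of_suspension (hZc : IsClosed Z) (l : E →L[ℝ] ℝ) (u : E) (hu : l u = 1)
    (hZ : ∀ x ∈ Z, ∀ t : ℝ, x + t • u ∈ Z)
    (h : Van (k + 1) (Z ∩ {x | l x = 0})ᶜ) : Van k Zᶜ := by
  rw [← compl_inter_inter_compl_inter l]
  refine Van.inter ?_ ?_ (van_compl_inter_halfSpace Z l u hu hZ)
    (van_compl_inter_halfSpace' Z l u hu hZ) (by rwa [compl_inter_union_compl_inter])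
  · exact (hZc.inter (isClosed_le l.continuous continuous_const)).isOpen_compl
  · exact (hZc.inter (isClosed_le continuous_const l.continuous)).isOpen_compl

lemma Van.suspension (hZc : IsClosed Z) (l : E →L[ℝ] ℝ) (u : E) (hu : l u = 1)
    (hZ : ∀ x ∈ Z, ∀ t : ℝ, x + t • u ∈ Z)
    (h : Van k Zᶜ) : Van (k + 1) (Z ∩ {x | l x = 0})ᶜ := by
  rw [← compl_inter_union_compl_inter]
  refine Van.union_of_van ?_ ?_ (van_compl_inter_halfSpace Z l u hu hZ)
    (van_compl_inter_halfSpace' Z l u hu hZ) (by rwa [compl_inter_inter_compl_inter])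
  · exact (hZc.inter (isClosed_le l.continuous continuous_const)).isOpen_compl
  · exact (hZc.inter (isClosed_le continuous_const l.continuous)).isOpen_compl

end

lemma van_compl_hyperplane (l : E →L[ℝ] ℝ) (u : E) (hu : l u = 1) :
    Van k {x | l x = 0}ᶜ := by
  rw [← univ_inter {x | l x = 0}, ← compl_inter_union_compl_inter]
  refine Van.union_of_disjoint ?_ ?_ (van_compl_inter_halfSpace univ l u hu fun _ _ _ => trivial)
    (van_compl_inter_halfSpace' univ l u hu fun _ _ _ => trivial)
    (by rw [compl_inter_inter_compl_inter, compl_univ])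
  · exact (isClosed_univ.inter (isClosed_le l.continuous continuous_const)).isOpen_compl
  · exact (isClosed_univ.inter (isClosed_le continuous_const l.continuous)).isOpen_compl

end

section

variable {n m : ℕ}

lemma van_compl_fst_eq_zero_below (i : ℕ) (hi : i ≤ n) : ∀ k, i ≤ k + 1 →
    Van k {p : EuclideanSpace ℝ (Fin n) × EuclideanSpace ℝ (Fin m) |
      ∀ j : Fin n, (j : ℕ) < i → p.1 j = 0}ᶜ := by
  induction i with
  | zero =>
    intro k _ z hz _
    simp only [not_lt_zero, false_implies, implies_true, ofPred_true, compl_univ] at hz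
    exact ⟨0, zero_mem _, by rw [NA_empty z hz, map_zero]⟩
  | succ i ih =>
    intro k hk
    let l : EuclideanSpace ℝ (Fin n) × EuclideanSpace ℝ (Fin m) →L[ℝ] ℝ :=
      (EuclideanSpace.proj (⟨i, hi⟩ : Fin n)).comp (ContinuousLinearMap.fst ℝ _ _)
    have hl : ∀ p, l p = p.1 ⟨i, hi⟩ := fun _ => rfl
    have e : {p : EuclideanSpace ℝ (Fin n) × EuclideanSpace ℝ (Fin m) |
        ∀ j : Fin n, (j : ℕ) < i + 1 → p.1 j = 0} =
        {p | ∀ j : Fin n, (j : ℕ) < i → p.1 j = 0} ∩ {p | l p = 0} := by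
      ext p
      simp only [mem_ofPred_eq, mem_inter_iff, hl]
      refine ⟨fun h => ⟨fun j hj => h j (by omega), h _ (Nat.lt_succ_self i)⟩, fun h j hj => ?_⟩
      rcases Nat.lt_succ_iff_lt_or_eq.1 hj with hj | hj
      · exact h.1 j hj
      · rw [← h.2]; exact congrArg _ (Fin.ext hj)
    rw [e]
    have hu : l (EuclideanSpace.single ⟨i, hi⟩ 1, 0) = 1 := by simp [hl]
    cases k with
    | zero =>
      obtain rfl : i = 0 := by omega
      simpa using van_compl_hyperplane l _ hu
    | succ k =>
      refine Van.suspension ?_ l _ hu ?_ (ih (by omega) k (by omega))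
      · simp only [ofPred_forall]
        exact isClosed_iInter fun j => isClosed_iInter fun _ =>
          isClosed_eq (by fun_prop) continuous_const
      · intro p hp t j hj
        have : j ≠ ⟨i, hi⟩ := fun h => by rw [h] at hj; exact lt_irrefl _ hj
        simp [hp j hj, this]

lemma van_compl_of_snd_eq_zero {S : Set (EuclideanSpace ℝ (Fin n))} (hS : IsClosed S)
    (h : ∀ k, m ≤ k → Van k {p : EuclideanSpace ℝ (Fin n) × EuclideanSpace ℝ (Fin m) |
      p.1 ∈ S ∧ p.2 = 0}ᶜ) (i : ℕ) (hi : i ≤ m) : ∀ k, i ≤ k →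
    Van k {p : EuclideanSpace ℝ (Fin n) × EuclideanSpace ℝ (Fin m) |
      p.1 ∈ S ∧ ∀ j : Fin m, (j : ℕ) < i → p.2 j = 0}ᶜ := by
  induction hi using Nat.decreasingInduction with
  | self =>
    convert h with k _ p
    refine ⟨fun h => ?_, fun h j _ => by simp [h]⟩
    ext j
    exact h j j.2
  | of_succ i hi ih =>
    intro k hk
    let l : EuclideanSpace ℝ (Fin n) × EuclideanSpace ℝ (Fin m) →L[ℝ] ℝ :=
      (EuclideanSpace.proj (⟨i, hi⟩ : Fin m)).comp (ContinuousLinearMap.snd ℝ _ _)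
    have hl : ∀ p, l p = p.2 ⟨i, hi⟩ := fun _ => rfl
    have e : {p : EuclideanSpace ℝ (Fin n) × EuclideanSpace ℝ (Fin m) |
        p.1 ∈ S ∧ ∀ j : Fin m, (j : ℕ) < i + 1 → p.2 j = 0} =
        {p | p.1 ∈ S ∧ ∀ j : Fin m, (j : ℕ) < i → p.2 j = 0} ∩ {p | l p = 0} := by
      ext p
      simp only [mem_ofPred_eq, mem_inter_iff, hl, and_assoc]
      refine and_congr_right fun _ => ⟨fun h => ⟨fun j hj => h j (by omega),
        h _ (Nat.lt_succ_self i)⟩, fun h j hj => ?_⟩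
      rcases Nat.lt_succ_iff_lt_or_eq.1 hj with hj | hj
      · exact h.1 j hj
      · rw [← h.2]; exact congrArg _ (Fin.ext hj)
    have hu : l (0, EuclideanSpace.single ⟨i, hi⟩ 1) = 1 := by simp [hl]
    refine Van.of_suspension ?_ l _ hu ?_ ?_
    · simp only [ofPred_and, ofPred_forall]
      exact (hS.preimage continuous_fst).inter <| isClosed_iInter fun j => isClosed_iInter fun _ =>
          isClosed_eq (by fun_prop) continuous_const
    · intro p hp t
      refine ⟨by simpa using hp.1, fun j hj => ?_⟩
      have : j ≠ ⟨i, hi⟩ := fun h => by rw [h] at hj; exact lt_irrefl _ hj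
      simp [hp.2 j hj, this]
    · rw [← e]
      exact ih (k + 1) (by omega)

/-- The complement of a closed hypersurface homeomorphic to a hyperplane has no homology in
positive dimensions. -/
theorem van_compl_range {e : EuclideanSpace ℝ (Fin m) → EuclideanSpace ℝ (Fin (m + 1))}
    (he : Topology.IsClosedEmbedding e) (k : ℕ) : Van k (range e)ᶜ := by
  obtain ⟨Φ, hΦ⟩ := ContinuousMap.exists_extension he (ContinuousMap.id _)
  have hΦe : ∀ y, Φ (e y) = y := fun y => DFunLike.congr_fun hΦ y
  have hec := he.continuous
  have h : ∀ k, m ≤ k → Van k {p : EuclideanSpace ℝ (Fin (m + 1)) × EuclideanSpace ℝ (Fin m) |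
      p.1 ∈ range e ∧ p.2 = 0}ᶜ := by
    intro k hk
    refine (van_compl_fst_eq_zero_below (m := m) (m + 1) le_rfl k (by omega)).of_retract
      ⟨fun p => ⟨(p.1.1 - e (p.1.2 + Φ p.1.1), p.1.2 + Φ p.1.1), fun hp => p.2 ?_⟩, by fun_prop⟩
      ⟨fun p => ⟨(p.1.1 + e p.1.2, p.1.2 - Φ (p.1.1 + e p.1.2)), fun hp => p.2 ?_⟩, by fun_prop⟩
      fun p => ?_
    · have h0 : p.1.1 = e (p.1.2 + Φ p.1.1) := by
        rw [← sub_eq_zero]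
        ext j
        exact hp j j.2
      refine ⟨⟨_, h0.symm⟩, ?_⟩
      have := congrArg Φ h0
      rw [hΦe] at this
      simpa using this
    · obtain ⟨⟨y, hy⟩, h2⟩ := hp
      simp only at hy h2
      rw [← hy, hΦe, sub_eq_zero] at h2
      rw [← h2] at hy
      intro j _
      have : p.1.1 = 0 := by simpa using hy.symm
      simp [this]
    · ext1
      simp
  refine (van_compl_of_snd_eq_zero he.isClosed_range h 0 (Nat.zero_le _) k
    (Nat.zero_le _)).of_retract ⟨fun x => ⟨(x.1, 0), fun hx => x.2 hx.1⟩, by fun_prop⟩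
    ⟨fun p => ⟨p.1.1, fun hp => p.2 ⟨hp, fun j hj => absurd hj (Nat.not_lt_zero _)⟩⟩, by fun_prop⟩
    fun x => rfl

end

section

variable {X : Type} [TopologicalSpace X] {k : ℕ}

/-- Concatenation of two cubes along a coordinate. -/
def concat (j : Fin k) (g g' : C(Cb k, X))
    (h : ∀ x, g (Function.update x j 1) = g' (Function.update x j 0)) : C(Cb k, X) :=
  ⟨fun t => if (t j : ℝ) ≤ 1 / 2
      then g (Function.update t j (projIcc 0 1 zero_le_one (2 * (t j : ℝ))))
      else g' (Function.update t j (projIcc 0 1 zero_le_one (2 * (t j : ℝ) - 1))), by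
    refine Continuous.if_le ?_ ?_ (by fun_prop) continuous_const fun t ht => ?_
    · exact g.continuous.comp (continuous_id.update j
        (continuous_projIcc.comp (by fun_prop)))
    · exact g'.continuous.comp (continuous_id.update j
        (continuous_projIcc.comp (by fun_prop)))
    · rw [ht]
      norm_num
      exact h t⟩

lemma concat_apply (j : Fin k) (g g' : C(Cb k, X))
    (h : ∀ x, g (Function.update x j 1) = g' (Function.update x j 0)) (t : Cb k) :
    concat j g g' h t = if (t j : ℝ) ≤ 1 / 2
      then g (Function.update t j (projIcc 0 1 zero_le_one (2 * (t j : ℝ))))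
      else g' (Function.update t j (projIcc 0 1 zero_le_one (2 * (t j : ℝ) - 1))) := rfl

lemma concat_cases (j : Fin k) (g g' : C(Cb k, X))
    (h : ∀ x, g (Function.update x j 1) = g' (Function.update x j 0)) (x : Cb k) :
    (∃ y, concat j g g' h x = g y ∧ (∀ i, i ≠ j → y i = x i) ∧ (x j = 0 → y j = 0) ∧ x j ≠ 1) ∨
    (∃ y, concat j g g' h x = g' y ∧ (∀ i, i ≠ j → y i = x i) ∧ (x j = 1 → y j = 1) ∧
      x j ≠ 0) := by
  rw [concat_apply]
  split_ifs with hx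
  · refine Or.inl ⟨_, rfl, fun i hi => Function.update_of_ne hi _ _, fun h0 => ?_, fun h1 => ?_⟩
    · simp [h0]
    · rw [h1] at hx; norm_num at hx
  · refine Or.inr ⟨_, rfl, fun i hi => Function.update_of_ne hi _ _, fun h0 => ?_, fun h1 => ?_⟩
    · simp only [Function.update_self, h0]; norm_num
    · rw [h1] at hx; norm_num at hx

lemma concat_comp_face_zero (j : Fin (k + 1)) (g g' : C(Cb (k + 1), X))
    (h : ∀ x, g (Function.update x j 1) = g' (Function.update x j 0)) :
    (concat j g g' h).comp (face j 0) = g.comp (face j 0) := by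
  ext x
  simp [concat_apply]

lemma concat_comp_face_one (j : Fin (k + 1)) (g g' : C(Cb (k + 1), X))
    (h : ∀ x, g (Function.update x j 1) = g' (Function.update x j 0)) :
    (concat j g g' h).comp (face j 1) = g'.comp (face j 1) := by
  ext x
  simp only [ContinuousMap.comp_apply, face_apply, concat_apply, Fin.insertNth_apply_same]
  norm_num

lemma face_update (i : Fin (k + 1)) (e : I) (l : Fin k) (x : Cb k) (v : I) :
    face i e (Function.update x l v) = Function.update (face i e x) (i.succAbove l) v :=
  Fin.insertNth_update (α := fun _ => I) i e l v x

lemma concat_comp_face (i : Fin (k + 1)) (l : Fin k) (g g' : C(Cb (k + 1), X))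
    (h : ∀ x, g (Function.update x (i.succAbove l) 1) =
      g' (Function.update x (i.succAbove l) 0)) (e : I) :
    (concat (i.succAbove l) g g' h).comp (face i e) =
      concat l (g.comp (face i e)) (g'.comp (face i e))
        (fun x => by simp only [ContinuousMap.comp_apply, face_update, h]) := by
  ext x
  simp only [ContinuousMap.comp_apply, concat_apply, face_update]
  simp

/-- A point on the codimension two skeleton of the cube. -/
def Codim2 (x : Cb k) : Prop :=
  ∃ i j, i ≠ j ∧ (x i = 0 ∨ x i = 1) ∧ (x j = 0 ∨ x j = 1)

lemma codim2_face (i : Fin (k + 1)) {e : I} (he : e = 0 ∨ e = 1) {x : Cb k}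
    (hx : x ∈ Cube.boundary (Fin k)) : Codim2 (face i e x) := by
  obtain ⟨j, hj⟩ := hx
  exact ⟨i, i.succAbove j, (Fin.succAbove_ne i j).symm, by simpa using he, by simpa using hj⟩

variable {p : X}

lemma concat_eq_of_codim2 (j : Fin k) (g g' : C(Cb k, X))
    (h : ∀ x, g (Function.update x j 1) = g' (Function.update x j 0))
    (hg : ∀ x, Codim2 x → g x = p) (hg' : ∀ x, Codim2 x → g' x = p) (x : Cb k) (hx : Codim2 x) :
    concat j g g' h x = p := by
  obtain ⟨a, b, hab, ha, hb⟩ := hx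
  rcases concat_cases j g g' h x with ⟨y, hy, hyi, hyj, hj⟩ | ⟨y, hy, hyi, hyj, hj⟩ <;> rw [hy]
  · refine hg y ⟨a, b, hab, ?_, ?_⟩
    · rcases eq_or_ne a j with rfl | h
      · exact Or.inl (hyj (ha.resolve_right hj))
      · rwa [hyi a h]
    · rcases eq_or_ne b j with rfl | h
      · exact Or.inl (hyj (hb.resolve_right hj))
      · rwa [hyi b h]
  · refine hg' y ⟨a, b, hab, ?_, ?_⟩
    · rcases eq_or_ne a j with rfl | h
      · exact Or.inr (hyj (ha.resolve_left hj))
      · rwa [hyi a h]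
    · rcases eq_or_ne b j with rfl | h
      · exact Or.inr (hyj (hb.resolve_left hj))
      · rwa [hyi b h]

/-- The cube obtained from `a` by merging the coordinates `l` and `l + 1` with a lattice
operation. -/
def conn (m : C(I × I, I)) (l : Fin k) (a : C(Cb k, X)) : C(Cb (k + 1), X) :=
  ⟨fun x => a (Function.update (l.castSucc.removeNth x) l (m (x l.castSucc, x l.succ))), by
    have : Continuous fun x : Cb (k + 1) => (l.castSucc.removeNth x : Cb k) :=
      continuous_pi fun i => continuous_apply _
    exact a.continuous.comp (this.update l (by fun_prop))⟩

lemma conn_apply (m : C(I × I, I)) (l : Fin k) (a : C(Cb k, X)) (x : Cb (k + 1)) :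
    conn m l a x =
      a (Function.update (l.castSucc.removeNth x) l (m (x l.castSucc, x l.succ))) := rfl

lemma conn_face_castSucc (m : C(I × I, I)) (l : Fin k) (a : C(Cb k, X)) (e : I) (x : Cb k) :
    conn m l a (face l.castSucc e x) = a (Function.update x l (m (e, x l))) := by
  have : face l.castSucc e x l.succ = x l := by
    rw [← Fin.succAbove_castSucc_self l, face_apply, Fin.insertNth_apply_succAbove]
  rw [conn_apply, this]
  simp

lemma conn_face_succ (m : C(I × I, I)) (l : Fin k) (a : C(Cb k, X)) (e : I) (x : Cb k) :
    conn m l a (face l.succ e x) = a (Function.update x l (m (x l, e))) := by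
  have : l.castSucc = l.succ.succAbove l := (Fin.succAbove_succ_self l).symm
  rw [conn_apply]
  congr 1
  funext t
  rcases eq_or_ne t l with rfl | ht
  · simp only [face_apply, Function.update_self, Fin.insertNth_apply_same]
    rw [this, Fin.insertNth_apply_succAbove]
  · rw [Function.update_of_ne ht, Function.update_of_ne ht, Fin.removeNth_apply]
    have : l.castSucc.succAbove t = l.succ.succAbove t := by
      rcases lt_or_gt_of_ne ht with h | h
      · rw [Fin.succAbove_of_castSucc_lt _ _ (Fin.castSucc_lt_castSucc_iff.2 h),
          Fin.succAbove_of_castSucc_lt _ _ (Fin.castSucc_lt_succ_iff.2 h.le)]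
      · rw [Fin.succAbove_of_le_castSucc _ _ (Fin.castSucc_le_castSucc_iff.2 h.le),
          Fin.succAbove_of_le_castSucc _ _ (Fin.succ_le_castSucc_iff.2 h)]
    rw [this, face_apply, Fin.insertNth_apply_succAbove]

lemma conn_eq_of_ne (m : C(I × I, I)) (l : Fin k) {a : C(Cb k, X)}
    (ha : ∀ x ∈ Cube.boundary (Fin k), a x = p) {x : Cb (k + 1)} {j : Fin (k + 1)}
    (hj : j ≠ l.castSucc) (hj' : j ≠ l.succ) (hx : x j = 0 ∨ x j = 1) : conn m l a x = p := by
  obtain ⟨t, rfl⟩ := Fin.exists_succAbove_eq hj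
  have ht : t ≠ l := by
    rintro rfl
    exact hj' (Fin.succAbove_castSucc_self t)
  exact ha _ ⟨t, by rwa [Function.update_of_ne ht]⟩

lemma conn_eq_of_codim2 {m : C(I × I, I)}
    (hm : ∀ s t, (s = 0 ∨ s = 1) → (t = 0 ∨ t = 1) → m (s, t) = 0 ∨ m (s, t) = 1) (l : Fin k)
    {a : C(Cb k, X)} (ha : ∀ x ∈ Cube.boundary (Fin k), a x = p) (x : Cb (k + 1))
    (hx : Codim2 x) : conn m l a x = p := by
  obtain ⟨i, j, hij, hi, hj⟩ := hx
  by_cases h1 : i ≠ l.castSucc ∧ i ≠ l.succ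
  · exact conn_eq_of_ne m l ha h1.1 h1.2 hi
  by_cases h2 : j ≠ l.castSucc ∧ j ≠ l.succ
  · exact conn_eq_of_ne m l ha h2.1 h2.2 hj
  refine ha _ ⟨l, ?_⟩
  rw [Function.update_self]
  apply hm <;> grind

/-- The maximum of two coordinates. -/
def maxI : C(I × I, I) := ⟨fun q => q.1 ⊔ q.2, by fun_prop⟩

/-- The minimum of two coordinates. -/
def minI : C(I × I, I) := ⟨fun q => q.1 ⊓ q.2, by fun_prop⟩

lemma maxI_eq_or (s t : I) (hs : s = 0 ∨ s = 1) (ht : t = 0 ∨ t = 1) :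
    maxI (s, t) = 0 ∨ maxI (s, t) = 1 := by
  rcases hs with rfl | rfl
  · simpa [maxI] using ht
  · exact Or.inr (max_eq_left unitInterval.le_one')

lemma minI_eq_or (s t : I) (hs : s = 0 ∨ s = 1) (ht : t = 0 ∨ t = 1) :
    minI (s, t) = 0 ∨ minI (s, t) = 1 := by
  rcases hs with rfl | rfl
  · exact Or.inl (min_eq_left unitInterval.nonneg')
  · have : minI (1, t) = t := min_eq_right unitInterval.le_one'
    rwa [this]

end

section

open scoped Topology.Homotopy

variable {X : Type} [TopologicalSpace X] {k : ℕ} [Nontrivial (Fin k)] {p : X}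

open Classical in
/-- The element of the homotopy group represented by a cube, zero if the cube is not constant on
the boundary. -/
def cl (p : X) (g : C(Cb k, X)) : Additive (HomotopyGroup (Fin k) X p) :=
  if h : g ∈ Ω^ (Fin k) X p then Additive.ofMul ⟦⟨g, h⟩⟧ else 0

lemma cl_coe (g : Ω^ (Fin k) X p) : cl p g.1 = Additive.ofMul ⟦g⟧ := dif_pos g.2

lemma cl_of_const {g : C(Cb k, X)} (hg : ∀ x, g x = p) : cl p g = 0 := by
  have h : g ∈ Ω^ (Fin k) X p := fun y _ => hg y
  rw [cl, dif_pos h, ← ofMul_one, HomotopyGroup.one_def]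
  congr 2
  exact Subtype.ext (ContinuousMap.ext hg)

lemma cl_concat (j : Fin k) (g g' : C(Cb k, X))
    (h : ∀ x, g (Function.update x j 1) = g' (Function.update x j 0))
    (hg : ∀ y ∈ Cube.boundary (Fin k), g y = p) (hg' : ∀ y ∈ Cube.boundary (Fin k), g' y = p) :
    cl p (concat j g g' h) = cl p g + cl p g' := by
  let g₀ : Ω^ (Fin k) X p := ⟨g, hg⟩
  let g₁ : Ω^ (Fin k) X p := ⟨g', hg'⟩
  have hc : concat j g g' h = (GenLoop.transAt j g₀ g₁).1 := rfl
  rw [add_comm, hc, show g = g₀.1 from rfl, show g' = g₁.1 from rfl, cl_coe, cl_coe, cl_coe]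
  exact congrArg Additive.ofMul (HomotopyGroup.mul_spec (i := j) (p := g₁) (q := g₀)).symm

lemma cl_eq_of_homotopy {g g' : C(Cb k, X)} (F : C(I × Cb k, X)) (h0 : ∀ x, F (0, x) = g x)
    (h1 : ∀ x, F (1, x) = g' x) (hF : ∀ t, ∀ x ∈ Cube.boundary (Fin k), F (t, x) = p) :
    cl p g = cl p g' := by
  have hg : g ∈ Ω^ (Fin k) X p := fun y hy => by rw [← h0, hF _ _ hy]
  have hg' : g' ∈ Ω^ (Fin k) X p := fun y hy => by rw [← h1, hF _ _ hy]
  rw [cl, cl, dif_pos hg, dif_pos hg']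
  congr 1
  exact Quotient.sound ⟨⟨⟨F, h0, h1⟩, fun t x hx => (hF t x hx).trans (hg x hx).symm⟩⟩

lemma exists_homotopy_of_cl_eq {g g' : C(Cb k, X)} (hg : ∀ y ∈ Cube.boundary (Fin k), g y = p)
    (hg' : ∀ y ∈ Cube.boundary (Fin k), g' y = p) (h : cl p g = cl p g') :
    ∃ F : C(I × Cb k, X), (∀ x, F (0, x) = g x) ∧ (∀ x, F (1, x) = g' x) ∧
      ∀ t, ∀ x ∈ Cube.boundary (Fin k), F (t, x) = p := by
  rw [cl, cl, dif_pos (show g ∈ Ω^ (Fin k) X p from hg),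
    dif_pos (show g' ∈ Ω^ (Fin k) X p from hg')] at h
  obtain ⟨F⟩ := Quotient.exact (Additive.ofMul.injective h)
  exact ⟨F.toContinuousMap, F.map_zero_left, F.map_one_left,
    fun t x hx => (F.prop' t x hx).trans (hg x hx)⟩

/-- The alternating sum of the classes of the faces of a cube. -/
def faceSum (p : X) (G : C(Cb (k + 1), X)) : Additive (HomotopyGroup (Fin k) X p) :=
  ∑ i : Fin (k + 1), (-1 : ℤ) ^ (i : ℕ) • (cl p (G.comp (face i 1)) - cl p (G.comp (face i 0)))

lemma faceSum_concat (j : Fin (k + 1)) (g g' : C(Cb (k + 1), X))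
    (h : ∀ x, g (Function.update x j 1) = g' (Function.update x j 0))
    (hg : ∀ x, Codim2 x → g x = p) (hg' : ∀ x, Codim2 x → g' x = p) :
    faceSum p (concat j g g' h) = faceSum p g + faceSum p g' := by
  rw [faceSum, faceSum, faceSum, ← Finset.sum_add_distrib]
  refine Finset.sum_congr rfl fun i _ => ?_
  rw [← smul_add]
  congr 1
  rcases eq_or_ne j i with rfl | hj
  · have : g.comp (face j 1) = g'.comp (face j 0) := by
      ext x
      have := h (face j 0 x)
      simpa using this
    rw [concat_comp_face_one, concat_comp_face_zero, this]
    abel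
  · obtain ⟨l, rfl⟩ := Fin.exists_succAbove_eq hj
    rw [concat_comp_face, concat_comp_face, cl_concat, cl_concat]
    · abel
    · exact fun y hy => hg _ (codim2_face i (Or.inl rfl) hy)
    · exact fun y hy => hg' _ (codim2_face i (Or.inl rfl) hy)
    · exact fun y hy => hg _ (codim2_face i (Or.inr rfl) hy)
    · exact fun y hy => hg' _ (codim2_face i (Or.inr rfl) hy)

lemma faceSum_conn_eq (m : C(I × I, I)) (l : Fin k) {a : C(Cb k, X)}
    (ha : ∀ x ∈ Cube.boundary (Fin k), a x = p) (hm : ∀ s t, m (s, t) = m (t, s)) :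
    faceSum p (conn m l a) = 0 := by
  have hf : ∀ e, (conn m l a).comp (face l.castSucc e) = (conn m l a).comp (face l.succ e) :=
    fun e => by
      ext x
      rw [ContinuousMap.comp_apply, ContinuousMap.comp_apply, conn_face_castSucc, conn_face_succ,
        hm]
  have hne : l.castSucc ≠ l.succ := Fin.castSucc_lt_succ.ne
  rw [faceSum, Finset.sum_eq_add (l.castSucc) l.succ hne]
  · rw [hf, hf, Fin.val_castSucc, Fin.val_succ, pow_succ, mul_neg_one, neg_smul, add_neg_cancel]
  · intro i _ hi
    rw [cl_of_const, cl_of_const, sub_self, smul_zero]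
    · exact fun x => conn_eq_of_ne m l ha hi.1 hi.2 (by simp)
    · exact fun x => conn_eq_of_ne m l ha hi.1 hi.2 (by simp)
  · simp
  · simp

/-- The homotopy addition theorem, for cubes whose faces past the coordinate `r` are constant. -/
lemma faceSum_eq_zero_aux (r : ℕ) (hr : r ≤ k) : ∀ G : C(Cb (k + 1), X),
    (∀ x, Codim2 x → G x = p) →
    (∀ x, ∀ j : Fin (k + 1), r < j → (x j = 0 ∨ x j = 1) → G x = p) → faceSum p G = 0 := by
  induction r with
  | zero =>
    intro G hG hr
    have hs : ∀ i : Fin (k + 1), i ≠ 0 → ∀ e, (e = 0 ∨ e = 1) → cl p (G.comp (face i e)) = 0 :=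
      fun i hi e he => cl_of_const fun x => hr _ i (Fin.pos_of_ne_zero hi) (by simpa using he)
    rw [faceSum, Finset.sum_eq_single 0]
    · rw [cl_eq_of_homotopy (g := G.comp (face 0 1)) (g' := G.comp (face 0 0))
        (G.comp ⟨fun q => face 0 (σ q.1) q.2, by simp only [face_apply]; fun_prop⟩)]
      · rw [sub_self, smul_zero]
      · intro x; simp
      · intro x; simp
      · rintro t x ⟨j, hj⟩
        exact hr _ j.succ (by simp) (by simpa using hj)
    · intro i _ hi
      rw [hs i hi 1 (Or.inr rfl), hs i hi 0 (Or.inl rfl), sub_self, smul_zero]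
    · simp
  | succ r ih =>
    intro G hG hGr
    let l : Fin k := ⟨r, hr⟩
    have hb : ∀ e, (e = 0 ∨ e = 1) → ∀ x ∈ Cube.boundary (Fin k), G.comp (face l.succ e) x = p :=
      fun e he x hx => hG _ (codim2_face _ he hx)
    have hupd : ∀ (x : Cb (k + 1)) (e : I),
        Function.update x l.succ e = face l.succ e (l.succ.removeNth x) := fun x e => by simp
    have h0 : ∀ x, conn minI l (G.comp (face l.succ 0)) (Function.update x l.succ 1) =
        G (Function.update x l.succ 0) := fun x => by
      rw [hupd, hupd, conn_face_succ]
      simp [minI, unitInterval.le_one']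
    let G₁ := concat l.succ (conn minI l (G.comp (face l.succ 0))) G h0
    have h1 : ∀ x, G₁ (Function.update x l.succ 1) =
        conn maxI l (G.comp (face l.succ 1)) (Function.update x l.succ 0) := fun x => by
      rw [hupd, hupd, conn_face_succ, ← ContinuousMap.comp_apply, concat_comp_face_one]
      simp [maxI]
    have hc0 := conn_eq_of_codim2 minI_eq_or l (hb 0 (Or.inl rfl))
    have hc1 := conn_eq_of_codim2 maxI_eq_or l (hb 1 (Or.inr rfl))
    have hG₁ := concat_eq_of_codim2 l.succ _ _ h0 hc0 hG
    have hS := faceSum_concat l.succ _ _ h1 hG₁ hc1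
    rw [faceSum_concat l.succ _ _ h0 hc0 hG, faceSum_conn_eq _ _ (hb 0 (Or.inl rfl)),
      faceSum_conn_eq _ _ (hb 1 (Or.inr rfl)), zero_add, add_zero] at hS
    · rw [← hS]
      refine ih (by omega) _ (concat_eq_of_codim2 l.succ _ _ h1 hG₁ hc1) fun x j hj hx => ?_
      rcases eq_or_ne j l.succ with rfl | hjl
      · rw [← Function.update_eq_self l.succ x, hupd]
        rcases hx with hx | hx <;> rw [hx, ← ContinuousMap.comp_apply]
        · rw [concat_comp_face_zero, concat_comp_face_zero, ContinuousMap.comp_apply,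
            conn_face_succ]
          exact hb 0 (Or.inl rfl) _ ⟨l, Or.inl (by simp [minI])⟩
        · rw [concat_comp_face_one, ContinuousMap.comp_apply, conn_face_succ]
          exact hb 1 (Or.inr rfl) _ ⟨l, Or.inr (by simp [maxI, unitInterval.le_one'])⟩
      · have hj1 : j ≠ l.castSucc := fun h => by
          rw [h] at hj
          exact lt_irrefl _ hj
        have hj2 : r + 1 < j := lt_of_le_of_ne hj fun h => hjl (Fin.ext h.symm)
        rcases concat_cases _ _ _ h1 x with ⟨y, hy, hyi, -⟩ | ⟨y, hy, hyi, -⟩ <;> rw [hy]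
        · rw [← hyi j hjl] at hx
          rcases concat_cases _ _ _ h0 y with ⟨z, hz, hzi, -⟩ | ⟨z, hz, hzi, -⟩ <;>
            rw [← hzi j hjl] at hx
          · exact hz.trans (conn_eq_of_ne _ _ (hb 0 (Or.inl rfl)) hj1 hjl hx)
          · exact hz.trans (hGr z j hj2 hx)
        · rw [← hyi j hjl] at hx
          exact conn_eq_of_ne _ _ (hb 1 (Or.inr rfl)) hj1 hjl hx
    · exact fun s t => max_comm s t
    · exact fun s t => min_comm s t

/-- The homotopy addition theorem. -/
theorem faceSum_eq_zero (G : C(Cb (k + 1), X)) (hG : ∀ x, Codim2 x → G x = p) :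
    faceSum p G = 0 :=
  faceSum_eq_zero_aux k le_rfl G hG fun _ j hj => absurd hj (by omega)

end

section

variable {X Y E : Type} [TopologicalSpace X] [TopologicalSpace Y] [TopologicalSpace E]
  [TietzeExtension.{0} E]

/-- A map which is constant on the fibres of a map of compact spaces factors through it. -/
lemma exists_factor [CompactSpace X] [CompactSpace Y] [T2Space Y] (q : C(X, Y)) (f : C(X, E))
    (h : ∀ x x', q x = q x' → f x = f x') : ∃ F : C(Y, E), ∀ x, F (q x) = f x := by
  let q' : C(X, range q) := ⟨rangeFactorization q, q.continuous.codRestrict _⟩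
  have hq' : Topology.IsQuotientMap q' :=
    q'.continuous.isClosedMap.isQuotientMap q'.continuous rangeFactorization_surjective
  have hf : Function.FactorsThrough f q' := fun a b hab => h a b (congrArg Subtype.val hab)
  let F := hq'.lift f hf
  obtain ⟨G, hG⟩ := F.exists_restrict_eq (isCompact_range q.continuous).isClosed
  refine ⟨G, fun x => ?_⟩
  have h1 : G (q x) = F (q' x) := DFunLike.congr_fun hG (q' x)
  exact h1.trans (DFunLike.congr_fun (hq'.lift_comp f hf) x)

end

section

variable {Y Z : Type*} [TopologicalSpace Y] [TopologicalSpace Z]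

/-- A family of cubes indexed by faces is compatible if it agrees on the common points of the
faces. -/
def Compat {k : ℕ} (S : Fin (k + 1) → I → Prop) (f : Fin (k + 1) → I → C(Cb k, Y)) : Prop :=
  ∀ i i' e e', (e = 0 ∨ e = 1) → (e' = 0 ∨ e' = 1) → S i e → S i' e' → ∀ x x',
    face i e x = face i' e' x' → f i e x = f i' e' x'

lemma face_injective {k : ℕ} (i : Fin (k + 1)) (e : I) : Function.Injective (face i e) :=
  fun x y h => by
    have := congrArg i.removeNth h
    simpa using this

lemma eq_of_face_eq {k : ℕ} {i : Fin (k + 1)} {e e' : I} {x x' : Cb k}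
    (h : face i e x = face i e' x') : e = e' ∧ x = x' := by
  have h1 : e = e' := by simpa using congrFun h i
  subst h1
  exact ⟨rfl, face_injective i e h⟩

lemma eq_face_of_face_eq {k : ℕ} {i : Fin (k + 2)} {j : Fin (k + 1)} {e e' : I}
    {x x' : Cb (k + 1)} (h : face i e x = face (i.succAbove j) e' x') :
    ∃ z, x = face j e' z ∧ x' = face (j.predAbove i) e z := by
  have hx : x j = e' := by
    have := congrFun h (i.succAbove j)
    simpa using this
  have hz : x = face j e' (j.removeNth x) := by rw [← hx]; simp
  refine ⟨j.removeNth x, hz, face_injective (i.succAbove j) e' ?_⟩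
  rw [← h, ← ContinuousMap.comp_apply, face_comp_face, ContinuousMap.comp_apply, ← hz]

lemma compat_of_comp_face {k : ℕ} {f : Fin (k + 2) → I → C(Cb (k + 1), Y)}
    (h : ∀ i j e e', (e = 0 ∨ e = 1) → (e' = 0 ∨ e' = 1) →
      (f (i.succAbove j) e').comp (face (j.predAbove i) e) = (f i e).comp (face j e')) :
    Compat (fun _ _ => True) f := by
  intro i i' e e' he he' _ _ x x' hx
  rcases Fin.eq_self_or_eq_succAbove i i' with rfl | ⟨j, rfl⟩
  · obtain ⟨rfl, rfl⟩ := eq_of_face_eq hx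
    rfl
  · obtain ⟨z, rfl, rfl⟩ := eq_face_of_face_eq hx
    exact DFunLike.congr_fun (h i j e e' he he').symm z

lemma compat_natural {k : ℕ} (F : C(Cb (k + 2), Y)) (Ψ : C(Cb (k + 1), Y) → C(Cb (k + 1), Z))
    (Ψ' : C(Cb k, Y) → C(Cb k, Z))
    (h : ∀ i j e e', (e = 0 ∨ e = 1) → (e' = 0 ∨ e' = 1) →
      (Ψ (F.comp (face i e))).comp (face j e') = Ψ' ((F.comp (face i e)).comp (face j e'))) :
    Compat (fun _ _ => True) fun i e => Ψ (F.comp (face i e)) :=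
  compat_of_comp_face fun i j e e' he he' => by
    rw [h _ _ _ _ he he', h _ _ _ _ he' he, ContinuousMap.comp_assoc, ContinuousMap.comp_assoc,
      face_comp_face]

lemma Compat.mono {k : ℕ} {S S' : Fin (k + 1) → I → Prop} {f : Fin (k + 1) → I → C(Cb k, Y)}
    (h : Compat S f) (hS : ∀ i e, S' i e → S i e) : Compat S' f :=
  fun i i' e e' he he' hs hs' => h i i' e e' he he' (hS i e hs) (hS i' e' hs')

lemma compat_one (f : Fin 1 → I → C(Cb 0, Y)) : Compat (fun _ _ => True) f := by
  intro i i' e e' he he' _ _ x x' hx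
  obtain rfl : i = i' := Fin.ext (by omega)
  obtain ⟨rfl, rfl⟩ := eq_of_face_eq hx
  rfl

end

section

variable {E : Type} [TopologicalSpace E] [TietzeExtension.{0} E] {k : ℕ} {O : Set E}

/-- A compatible family of cubes consists of faces of a cube. -/
lemma Compat.exists_glue {S : Fin (k + 1) → I → Prop} {f : Fin (k + 1) → I → C(Cb k, E)}
    (h : Compat S f) : ∃ F : C(Cb (k + 1), E), ∀ i e, (e = 0 ∨ e = 1) → S i e →
      F.comp (face i e) = f i e := by
  classical
  let ι := {s : Fin (k + 1) × Bool // S s.1 (if s.2 then 1 else 0)}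
  have key : ∀ b : Bool, (if b then (1 : I) else 0) = 0 ∨ (if b then (1 : I) else 0) = 1 := by
    rintro (_ | _) <;> simp
  let q : C((Σ _ : ι, Cb k), Cb (k + 1)) :=
    ⟨fun s => face s.1.1.1 (if s.1.1.2 then 1 else 0) s.2,
      continuous_sigma fun i => (face i.1.1 (if i.1.2 then 1 else 0)).continuous⟩
  let g : C((Σ _ : ι, Cb k), E) :=
    ⟨fun s => f s.1.1.1 (if s.1.1.2 then 1 else 0) s.2,
      continuous_sigma fun i => (f i.1.1 (if i.1.2 then 1 else 0)).continuous⟩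
  obtain ⟨F, hF⟩ := exists_factor q g fun s s' hs =>
    h _ _ _ _ (key _) (key _) s.1.2 s'.1.2 _ _ hs
  refine ⟨F, fun i e he hS => ContinuousMap.ext fun x => ?_⟩
  rcases he with rfl | rfl
  · exact hF ⟨⟨(i, false), by simpa using hS⟩, x⟩
  · exact hF ⟨⟨(i, true), by simpa using hS⟩, x⟩

/-- The centred coordinates of a point of the cube, other than the last coordinate. -/
def boxVec (x : Cb (k + 1)) : Fin k → ℝ := fun j => (x j.castSucc : ℝ) - 1 / 2

lemma norm_boxVec_le (x : Cb (k + 1)) : ‖boxVec x‖ ≤ 1 / 2 := by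
  refine (pi_norm_le_iff_of_nonneg (by norm_num)).2 fun j => ?_
  rw [boxVec, Real.norm_eq_abs, abs_le]
  constructor <;> linarith [(x j.castSucc).2.1, (x j.castSucc).2.2]

/-- The reciprocal of the scaling factor of the radial retraction onto the open box. -/
def boxScale (x : Cb (k + 1)) : ℝ := ((2 - (x (Fin.last k) : ℝ)) / 2) ⊔ (2 * ‖boxVec x‖)

lemma boxScale_pos (x : Cb (k + 1)) : 0 < boxScale x :=
  lt_sup_of_lt_left (by linarith [(x (Fin.last k)).2.2])

lemma boxScale_le_one (x : Cb (k + 1)) : boxScale x ≤ 1 :=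
  sup_le (by linarith [(x (Fin.last k)).2.1]) (by linarith [norm_boxVec_le x])

lemma continuous_boxVec : Continuous (boxVec : Cb (k + 1) → Fin k → ℝ) := by
  unfold boxVec; fun_prop

lemma continuous_boxScale : Continuous (boxScale : Cb (k + 1) → ℝ) := by
  have := continuous_boxVec (k := k)
  unfold boxScale; fun_prop

/-- The radial retraction of the cube onto the box without the lid `x (last) = 1`. -/
def boxRetract : C(Cb (k + 1), Cb (k + 1)) :=
  ⟨fun x => Fin.snoc (α := fun _ => I)
    (fun j => projIcc 0 1 zero_le_one (1 / 2 + (boxScale x)⁻¹ * boxVec x j))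
    (projIcc 0 1 zero_le_one (2 - (boxScale x)⁻¹ * (2 - (x (Fin.last k) : ℝ)))), by
    have h1 := continuous_boxVec (k := k)
    have h2 : Continuous fun x : Cb (k + 1) => (boxScale x)⁻¹ :=
      continuous_boxScale.inv₀ fun x => (boxScale_pos x).ne'
    refine continuous_pi fun i => ?_
    refine Fin.lastCases ?_ (fun j => ?_) i
    · simp only [Fin.snoc_last]
      exact continuous_projIcc.comp (by fun_prop)
    · simp only [Fin.snoc_castSucc]
      exact continuous_projIcc.comp (continuous_const.add
        (h2.mul ((continuous_apply j).comp h1)))⟩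

/-- The box without the lid `x (last) = 1`. -/
def box (k : ℕ) : Set (Cb (k + 1)) :=
  {x | x (Fin.last k) = 0 ∨ ∃ j : Fin k, x j.castSucc = 0 ∨ x j.castSucc = 1}

lemma boxRetract_mem (x : Cb (k + 1)) : boxRetract x ∈ box k := by
  have hpos := boxScale_pos x
  rcases max_choice ((2 - (x (Fin.last k) : ℝ)) / 2) (2 * ‖boxVec x‖) with h | h
  · left
    have h : boxScale x = (2 - (x (Fin.last k) : ℝ)) / 2 := h
    have : 2 - (x (Fin.last k) : ℝ) = 2 * boxScale x := by rw [h]; ring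
    simp only [boxRetract, ContinuousMap.coe_mk, Fin.snoc_last]
    rw [this, mul_left_comm, inv_mul_cancel₀ hpos.ne']
    norm_num
  · right
    have h : boxScale x = 2 * ‖boxVec x‖ := h
    by_contra! hne
    have hlt : ∀ j, ‖boxVec x j‖ < ‖boxVec x‖ := fun j => by
      obtain ⟨h0, h1⟩ := hne j
      simp only [boxRetract, ContinuousMap.coe_mk, Fin.snoc_castSucc] at h0 h1
      have h0' : ¬ (1 / 2 + (boxScale x)⁻¹ * boxVec x j ≤ 0) := fun h =>
        h0 (projIcc_of_le_left _ h)
      have h1' : ¬ (1 ≤ 1 / 2 + (boxScale x)⁻¹ * boxVec x j) := fun h =>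
        h1 (projIcc_of_right_le _ h)
      have h2 : boxVec x j = boxScale x * ((boxScale x)⁻¹ * boxVec x j) := by field_simp
      rw [h2, norm_mul, Real.norm_of_nonneg hpos.le]
      have h3 : ‖(boxScale x)⁻¹ * boxVec x j‖ < 1 / 2 := by
        rw [Real.norm_eq_abs, abs_lt]; constructor <;> linarith
      nlinarith
    have hn : 0 < ‖boxVec x‖ := by linarith
    exact lt_irrefl _ ((pi_norm_lt_iff hn).2 hlt)

lemma boxRetract_of_mem {x : Cb (k + 1)} (hx : x ∈ box k) : boxRetract x = x := by
  have h1 : boxScale x = 1 := by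
    refine le_antisymm (boxScale_le_one x) ?_
    rcases hx with hx | ⟨j, hx⟩
    · exact le_sup_of_le_left (by rw [hx]; norm_num)
    · refine le_sup_of_le_right ?_
      have h2 := norm_le_pi_norm (boxVec x) j
      have h3 : ‖boxVec x j‖ = 1 / 2 := by
        rw [boxVec, Real.norm_eq_abs]
        rcases hx with hx | hx <;> rw [hx] <;> norm_num
      linarith
  funext i
  refine Fin.lastCases ?_ (fun j => ?_) i
  · simp only [boxRetract, ContinuousMap.coe_mk, Fin.snoc_last, h1]
    simp
  · simp only [boxRetract, ContinuousMap.coe_mk, Fin.snoc_castSucc, h1, boxVec]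
    simp

lemma mem_box_face_last_zero (x : Cb k) : face (Fin.last k) 0 x ∈ box k := Or.inl (by simp)

lemma mem_box_face_castSucc {k : ℕ} (i : Fin (k + 1)) {e : I} (he : e = 0 ∨ e = 1)
    (x : Cb (k + 1)) : face i.castSucc e x ∈ box (k + 1) := Or.inr ⟨i, by simpa using he⟩

end

section

variable {Y : Type*} [TopologicalSpace Y] {k : ℕ}

lemma face_last_init (x : Cb (k + 1)) :
    face (Fin.last k) (x (Fin.last k)) (Fin.init x) = x := by
  rw [face_apply, Fin.insertNth_last', Fin.snoc_init_self]

lemma face_castSucc_face_last (i : Fin (k + 1)) (e t : I) (y : Cb k) :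
    face i.castSucc e (face (Fin.last k) t y) = face (Fin.last (k + 1)) t (face i e y) := by
  have h := DFunLike.congr_fun (face_comp_face i.castSucc (Fin.last k) e t) y
  have h1 : i.castSucc.succAbove (Fin.last k) = Fin.last (k + 1) := by
    rw [Fin.succAbove_of_le_castSucc _ _ (Fin.castSucc_le_castSucc_iff.2 (Fin.le_last i)),
      Fin.succ_last]
  have h2 : (Fin.last k).predAbove i.castSucc = i := by simp
  rw [h1, h2] at h
  exact h.symm

lemma prTail_comp_face_zero (e : I) : (prTail k).comp (face 0 e) = ContinuousMap.id _ := by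
  ext x
  simp [prTail]

lemma prTail_comp_face_succ (i : Fin (k + 1)) (e : I) :
    (prTail (k + 1)).comp (face i.succ e) = (face i e).comp (prTail k) := by
  rw [((isDeg_prTail (k + 1)).face_succ i e).eq_comp 0]
  congr 1
  have h := face_comp_face 0 i 0 e
  simp only [Fin.succAbove_zero, Fin.predAbove_right_zero] at h
  rw [ContinuousMap.comp_assoc, h, ← ContinuousMap.comp_assoc, prTail_comp_face_zero,
    ContinuousMap.id_comp]

/-- The reflection of the last coordinate. -/
def reflLast : C(Cb (k + 1), Cb (k + 1)) :=
  ⟨fun x => Function.update x (Fin.last k) (σ (x (Fin.last k))),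
    continuous_id.update _ (by fun_prop)⟩

lemma reflLast_face_last (e : I) (y : Cb k) :
    reflLast (face (Fin.last k) e y) = face (Fin.last k) (σ e) y := by
  simp [reflLast, Fin.insertNth_last']
  rw [Fin.update_snoc_last]

lemma reflLast_face_castSucc (i : Fin (k + 1)) (e : I) (x : Cb (k + 1)) :
    reflLast (face i.castSucc e x) = face i.castSucc e (reflLast x) := by
  rw [← face_last_init x, face_castSucc_face_last, reflLast_face_last, reflLast_face_last,
    face_castSucc_face_last]

end

section

variable {E : Type} [TopologicalSpace E] [TietzeExtension.{0} E] {k : ℕ} {O : Set E}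

/-- Every open box in a set can be filled. -/
lemma kan (B : C(Cb (k + 1), E)) (Φ : Fin (k + 1) → I → C(Cb (k + 1), E)) (hB : ∀ x, B x ∈ O)
    (hΦ : ∀ i e, (e = 0 ∨ e = 1) → ∀ x, Φ i e x ∈ O)
    (hBΦ : ∀ i e, (e = 0 ∨ e = 1) → (Φ i e).comp (face (Fin.last k) 0) = B.comp (face i e))
    (hc : ∀ t, Compat (fun _ _ => True) fun i e => (Φ i e).comp (face (Fin.last k) t)) :
    ∃ M : C(Cb (k + 2), E), (∀ x, M x ∈ O) ∧ M.comp (face (Fin.last (k + 1)) 0) = B ∧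
      ∀ i e, (e = 0 ∨ e = 1) → M.comp (face i.castSucc e) = Φ i e := by
  let f : Fin (k + 2) → I → C(Cb (k + 1), E) := fun i e =>
    Fin.lastCases (motive := fun _ => C(Cb (k + 1), E)) B (fun j => Φ j e) i
  have f1 : ∀ e, f (Fin.last (k + 1)) e = B := fun e => by simp [f]
  have f2 : ∀ i e, f (Fin.castSucc i) e = Φ i e := fun i e => by simp [f]
  have hBΦ' : ∀ i e, (e = 0 ∨ e = 1) → ∀ x x',
      face (Fin.last (k + 1)) 0 x = face (Fin.castSucc i) e x' → B x = Φ i e x' := by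
    intro i e he x x' hx
    rw [← face_last_init x', face_castSucc_face_last] at hx
    obtain ⟨h0, rfl⟩ := eq_of_face_eq hx
    have hx' : face (Fin.last k) 0 (Fin.init x') = x' := by rw [h0, face_last_init]
    exact (DFunLike.congr_fun (hBΦ i e he) _).symm.trans (congrArg (Φ i e) hx')
  have hf : Compat (fun i e => i = Fin.last (k + 1) → e = 0) f := by
    intro i i' e e' he he' hs hs' x x'
    induction i using Fin.lastCases with
    | last =>
      induction i' using Fin.lastCases with
      | last =>
        intro hx
        obtain ⟨rfl, rfl⟩ := eq_of_face_eq hx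
        rfl
      | cast i' =>
        rw [hs rfl, f1, f2]
        exact hBΦ' i' e' he' x x'
    | cast i =>
      induction i' using Fin.lastCases with
      | last =>
        rw [hs' rfl, f1, f2]
        exact fun hx => (hBΦ' i e he x' x hx.symm).symm
      | cast i' =>
        intro hx
        rw [← face_last_init x, ← face_last_init x', face_castSucc_face_last,
          face_castSucc_face_last] at hx
        obtain ⟨h1, h2⟩ := eq_of_face_eq hx
        have := hc (x (Fin.last k)) i i' e e' he he' trivial trivial _ _ h2
        rw [f2, f2, ← face_last_init x, ← face_last_init x', ← h1]
        exact this
  obtain ⟨F, hF⟩ := hf.exists_glue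
  have hFl : F.comp (face (Fin.last (k + 1)) 0) = B :=
    (hF _ 0 (Or.inl rfl) fun _ => rfl).trans (f1 0)
  have hFs : ∀ i e, (e = 0 ∨ e = 1) → F.comp (face (Fin.castSucc i) e) = Φ i e := fun i e he =>
    (hF _ e he fun h => absurd h (Fin.castSucc_lt_last i).ne).trans (f2 i e)
  refine ⟨F.comp boxRetract, fun x => ?_, ?_, fun i e he => ?_⟩
  · rw [ContinuousMap.comp_apply]
    rcases boxRetract_mem x with h | ⟨j, h⟩
    · rw [← face_last_init (boxRetract x), h, ← ContinuousMap.comp_apply, hFl]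
      exact hB _
    · have : face j.castSucc (boxRetract x j.castSucc) (j.castSucc.removeNth (boxRetract x)) =
          boxRetract x := by simp
      rw [← this, ← ContinuousMap.comp_apply, hFs j _ h]
      exact hΦ _ _ h _
  · rw [← hFl]
    ext x
    simp only [ContinuousMap.comp_apply]
    rw [boxRetract_of_mem (mem_box_face_last_zero x)]
  · rw [← hFs i e he]
    ext x
    simp only [ContinuousMap.comp_apply]
    rw [boxRetract_of_mem (mem_box_face_castSucc i he x)]

/-- Every open box in a set can be filled, with the lid in place of the bottom. -/
lemma kan' (B : C(Cb (k + 1), E)) (Φ : Fin (k + 1) → I → C(Cb (k + 1), E)) (hB : ∀ x, B x ∈ O)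
    (hΦ : ∀ i e, (e = 0 ∨ e = 1) → ∀ x, Φ i e x ∈ O)
    (hBΦ : ∀ i e, (e = 0 ∨ e = 1) → (Φ i e).comp (face (Fin.last k) 1) = B.comp (face i e))
    (hc : ∀ t, Compat (fun _ _ => True) fun i e => (Φ i e).comp (face (Fin.last k) t)) :
    ∃ M : C(Cb (k + 2), E), (∀ x, M x ∈ O) ∧ M.comp (face (Fin.last (k + 1)) 1) = B ∧
      ∀ i e, (e = 0 ∨ e = 1) → M.comp (face i.castSucc e) = Φ i e := by
  have hr : ∀ (c : C(Cb (k + 1), E)) t,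
      (c.comp reflLast).comp (face (Fin.last k) t) = c.comp (face (Fin.last k) (σ t)) :=
    fun c t => ContinuousMap.ext fun x => congrArg c (reflLast_face_last t x)
  obtain ⟨M, hM, hMl, hMs⟩ := kan (O := O) B (fun i e => (Φ i e).comp reflLast) hB
    (fun i e he x => hΦ i e he _)
    (fun i e he => by rw [hr, unitInterval.symm_zero, hBΦ i e he])
    (fun t => by simpa only [hr] using hc (σ t))
  refine ⟨M.comp reflLast, fun x => hM _, ?_, fun i e he => ?_⟩
  · rw [← hMl]
    ext x
    simp only [ContinuousMap.comp_apply]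
    rw [reflLast_face_last, unitInterval.symm_one]
  · ext x
    simp only [ContinuousMap.comp_apply]
    rw [reflLast_face_castSucc, ← ContinuousMap.comp_apply, hMs i e he, ContinuousMap.comp_apply]
    congr 1
    simp [reflLast]

/-- Maps from the boundary of the `k`-cube into `O` extend to the cube. -/
def HE (k : ℕ) (O : Set E) : Prop :=
  ∀ F : C(Cb k, E), (∀ x ∈ Cube.boundary (Fin k), F x ∈ O) →
    ∃ G : C(Cb k, E), (∀ x, G x ∈ O) ∧ ∀ x ∈ Cube.boundary (Fin k), G x = F x

lemma face_mem_boundary {k : ℕ} (i : Fin (k + 1)) {e : I} (he : e = 0 ∨ e = 1) (x : Cb k) :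
    face i e x ∈ Cube.boundary (Fin (k + 1)) := ⟨i, by simpa using he⟩

lemma exists_face_of_mem_boundary {k : ℕ} {x : Cb (k + 1)} (hx : x ∈ Cube.boundary (Fin (k + 1))) :
    ∃ i e y, (e = 0 ∨ e = 1) ∧ x = face i e y := by
  obtain ⟨i, hi⟩ := hx
  exact ⟨i, x i, i.removeNth x, hi, by simp⟩

lemma HE.exists_filler (h : HE (k + 1) O) {f : Fin (k + 1) → I → C(Cb k, E)}
    (hf : Compat (fun _ _ => True) f) (hO : ∀ i e, (e = 0 ∨ e = 1) → ∀ x, f i e x ∈ O) :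
    ∃ G : C(Cb (k + 1), E), (∀ x, G x ∈ O) ∧
      ∀ i e, (e = 0 ∨ e = 1) → G.comp (face i e) = f i e := by
  obtain ⟨F, hF⟩ := hf.exists_glue
  obtain ⟨G, hG, hGF⟩ := h F fun x hx => by
    obtain ⟨i, e, y, he, rfl⟩ := exists_face_of_mem_boundary hx
    rw [← ContinuousMap.comp_apply, hF i e he trivial]
    exact hO i e he y
  refine ⟨G, hG, fun i e he => ?_⟩
  rw [← hF i e he trivial]
  ext x
  exact hGF _ (face_mem_boundary i he x)

end

section

variable {E : Type} [TopologicalSpace E] {k : ℕ} {O : Set E}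

open Classical in
/-- A replacement of cubes by cubes in `O`, compatible with faces and degeneracies. -/
def repl (O : Set E) : (k : ℕ) → C(Cb k, E) → C(Cb k, E)
  | 0, c => if ∀ x, c x ∈ O then c else
      if h : ∃ G : C(Cb 0, E), ∀ x, G x ∈ O then h.choose else c
  | k + 1, c => if ∀ x, c x ∈ O then c else
      if IsDeg c then (repl O k (c.comp (face 0 0))).comp (prTail k) else
      if h : ∃ G : C(Cb (k + 1), E), (∀ x, G x ∈ O) ∧ ∀ i e, (e = 0 ∨ e = 1) →
        G.comp (face i e) = repl O k (c.comp (face i e)) then h.choose else c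

lemma repl_of_mem {c : C(Cb k, E)} (hc : ∀ x, c x ∈ O) : repl O k c = c := by
  cases k <;> rw [repl, if_pos hc]

lemma repl_comp_prTail (b : C(Cb k, E)) :
    repl O (k + 1) (b.comp (prTail k)) = (repl O k b).comp (prTail k) := by
  have hb : (b.comp (prTail k)).comp (face 0 0) = b := by
    ext x; simp [prTail]
  by_cases h : ∀ x, b x ∈ O
  · have hb' : ∀ x, (b.comp (prTail k)) x ∈ O := fun x => h _
    rw [repl_of_mem h, repl_of_mem hb']
  · have h1 : ¬ ∀ x, (b.comp (prTail k)) x ∈ O := fun h1 => h fun x => by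
      rw [← hb]; exact h1 _
    rw [repl, if_neg h1, if_pos ((isDeg_prTail k).comp b), hb]

end

section

variable {E : Type} [TopologicalSpace E] [TietzeExtension.{0} E] {k : ℕ} {O : Set E}

lemma repl_spec (K : ℕ) (h : ∀ j ≤ K, HE j O) : ∀ k ≤ K,
    (∀ c : C(Cb k, E), ∀ x, repl O k c x ∈ O) ∧
    ∀ m : ℕ, k = m + 1 → ∀ (c : C(Cb (m + 1), E)) i e, (e = 0 ∨ e = 1) →
      (repl O (m + 1) c).comp (face i e) = repl O m (c.comp (face i e)) := by
  intro k
  induction k with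
  | zero =>
    refine fun hk => ⟨fun c => ?_, fun m hm => absurd hm (by omega)⟩
    have hex : ∃ G : C(Cb 0, E), ∀ x, G x ∈ O := by
      obtain ⟨G, hG, -⟩ := h 0 hk c fun x ⟨i, _⟩ => i.elim0
      exact ⟨G, hG⟩
    rw [repl]
    split_ifs with hc
    · exact hc
    · exact hex.choose_spec
  | succ k ih =>
    intro hk
    obtain ⟨ih1, ih2⟩ := ih (by omega)
    have key : ∀ c : C(Cb (k + 1), E), (∀ x, repl O (k + 1) c x ∈ O) ∧
        ∀ i e, (e = 0 ∨ e = 1) →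
          (repl O (k + 1) c).comp (face i e) = repl O k (c.comp (face i e)) := by
      intro c
      by_cases hc : ∀ x, c x ∈ O
      · rw [repl_of_mem hc]
        exact ⟨hc, fun i e _ => (repl_of_mem (c := c.comp (face i e)) fun x => hc _).symm⟩
      by_cases hd : IsDeg c
      · rw [hd.eq_comp 0, repl_comp_prTail]
        refine ⟨fun x => ih1 _ _, fun i e he => ?_⟩
        generalize c.comp (face 0 0) = b
        induction i using Fin.cases with
        | zero =>
          rw [ContinuousMap.comp_assoc, ContinuousMap.comp_assoc, prTail_comp_face_zero,
            ContinuousMap.comp_id, ContinuousMap.comp_id]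
        | succ i =>
          cases k with
          | zero => exact i.elim0
          | succ k =>
            rw [ContinuousMap.comp_assoc, ContinuousMap.comp_assoc, prTail_comp_face_succ,
              ← ContinuousMap.comp_assoc, ← ContinuousMap.comp_assoc, repl_comp_prTail,
              ih2 k rfl _ _ _ he]
      · have hcompat : Compat (fun _ _ => True) fun i e => repl O k (c.comp (face i e)) := by
          cases k with
          | zero => exact compat_one _
          | succ k =>
            exact compat_natural c (repl O (k + 1)) (repl O k) fun i j e e' he he' =>
              ih2 k rfl _ _ _ he'
        have hex := (h (k + 1) hk).exists_filler hcompat fun i e he x => ih1 _ x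
        rw [repl, if_neg hc, if_neg hd, dif_pos hex]
        exact hex.choose_spec
    refine ⟨fun c => (key c).1, fun m hm => ?_⟩
    obtain rfl : k = m := by omega
    exact fun c => (key c).2

lemma repl_mem (h : ∀ j ≤ k, HE j O) (c : C(Cb k, E)) (x : Cb k) : repl O k c x ∈ O :=
  (repl_spec k h k le_rfl).1 c x

lemma repl_comp_face (h : ∀ j ≤ k + 1, HE j O) (c : C(Cb (k + 1), E)) (i : Fin (k + 1)) {e : I}
    (he : e = 0 ∨ e = 1) : (repl O (k + 1) c).comp (face i e) = repl O k (c.comp (face i e)) :=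
  (repl_spec (k + 1) h (k + 1) le_rfl).2 k rfl c i e he

end

section

variable {Y Z : Type*} [TopologicalSpace Y] [TopologicalSpace Z] {k : ℕ}

lemma comp_face_castSucc_comp_face_last (c : C(Cb (k + 2), Y)) (i : Fin (k + 1)) (e t : I) :
    (c.comp (face i.castSucc e)).comp (face (Fin.last k) t) =
      (c.comp (face (Fin.last (k + 1)) t)).comp (face i e) :=
  ContinuousMap.ext fun y => congrArg c (face_castSucc_face_last i e t y)

lemma cylCube_comp_prTail (Φ : C(Y × I, Z)) (b : C(Cb k, Y)) :
    cylCube Φ (b.comp (prTail k)) = (cylCube Φ b).comp (prTail (k + 1)) := rfl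

end

section

variable {E : Type} [NormedAddCommGroup E] [NormedSpace ℝ E] {k : ℕ} {O : Set E} {p : E}

/-- The straight line contraction to a point. -/
def lineTo (p : E) : C(E × I, E) :=
  ⟨fun q => (1 - (q.2 : ℝ)) • q.1 + (q.2 : ℝ) • p, by fun_prop⟩

lemma slice_lineTo_zero (p : E) : slice (lineTo p) 0 = ContinuousMap.id E := by
  ext x; simp [slice, lineTo]

lemma slice_lineTo_one (p : E) : slice (lineTo p) 1 = ContinuousMap.const E p := by
  ext x; simp [slice, lineTo]

/-- A cube in `O` joining a cube in `O` to the constant cube. -/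
def side (O : Set E) (p : E) {k : ℕ} (c : C(Cb k, E)) : C(Cb (k + 1), E) :=
  repl O (k + 1) (cylCube (lineTo p) c)

lemma side_comp_prTail (b : C(Cb k, E)) :
    side O p (b.comp (prTail k)) = (side O p b).comp (prTail (k + 1)) := by
  rw [side, cylCube_comp_prTail, repl_comp_prTail, side]

/-- A prism in `O` over a cube in `O`, whose sides are the cubes `side`. -/
structure IsPrism (O : Set E) (p : E) (c : C(Cb (k + 1), E)) (M : C(Cb (k + 2), E)) : Prop where
  mem : ∀ x, M x ∈ O
  bot : M.comp (face (Fin.last (k + 1)) 0) = c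
  sides : ∀ i e, (e = 0 ∨ e = 1) → M.comp (face (Fin.castSucc i) e) = side O p (c.comp (face i e))
  deg : IsDeg c → ∀ x, M (face (Fin.last (k + 1)) 1 x) = p

open Classical in
/-- A choice of a prism over a cube. -/
def prism (O : Set E) (p : E) (c : C(Cb (k + 1), E)) : C(Cb (k + 2), E) :=
  if h : ∃ M, IsPrism O p c M then h.choose else ContinuousMap.const _ p

/-- The face of the prism opposite to the original cube. -/
def top (O : Set E) (p : E) (c : C(Cb (k + 1), E)) : C(Cb (k + 1), E) :=
  (prism O p c).comp (face (Fin.last (k + 1)) 1)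

variable [TietzeExtension.{0} E]

lemma side_mem (h : ∀ j ≤ k + 1, HE j O) (c : C(Cb k, E)) (x : Cb (k + 1)) : side O p c x ∈ O :=
  repl_mem h _ x

lemma side_comp_face_castSucc (h : ∀ j ≤ k + 2, HE j O) (c : C(Cb (k + 1), E)) (i : Fin (k + 1))
    {e : I} (he : e = 0 ∨ e = 1) :
    (side O p c).comp (face i.castSucc e) = side O p (c.comp (face i e)) := by
  rw [side, repl_comp_face h _ _ he, cylCube_face_castSucc, side]

lemma side_comp_face_last_zero (h : ∀ j ≤ k + 1, HE j O) {c : C(Cb k, E)} (hc : ∀ x, c x ∈ O) :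
    (side O p c).comp (face (Fin.last k) 0) = c := by
  rw [side, repl_comp_face h _ _ (Or.inl rfl), cylCube_face_last, slice_lineTo_zero,
    ContinuousMap.id_comp, repl_of_mem hc]

lemma side_comp_face_last_one (h : ∀ j ≤ k + 1, HE j O) (hp : p ∈ O) (c : C(Cb k, E)) :
    (side O p c).comp (face (Fin.last k) 1) = ContinuousMap.const _ p := by
  rw [side, repl_comp_face h _ _ (Or.inr rfl), cylCube_face_last, slice_lineTo_one,
    ContinuousMap.const_comp, repl_of_mem fun _ => hp]

lemma exists_isPrism (h : ∀ j ≤ k + 2, HE j O) (hp : p ∈ O) {c : C(Cb (k + 2), E)}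
    (hc : ∀ x, c x ∈ O) : ∃ M, IsPrism O p c M := by
  have h' : ∀ j ≤ k + 1, HE j O := fun j hj => h j (by omega)
  by_cases hd : IsDeg c
  · obtain ⟨b, rfl⟩ : ∃ b : C(Cb (k + 1), E), c = b.comp (prTail (k + 1)) := ⟨_, hd.eq_comp 0⟩
    have hb : ∀ x, b x ∈ O := fun x => by
      have := hc (face 0 0 x)
      rwa [← ContinuousMap.comp_apply, ContinuousMap.comp_assoc, prTail_comp_face_zero] at this
    have hl : ∀ t, (prTail (k + 2)).comp (face (Fin.last (k + 2)) t) =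
        (face (Fin.last (k + 1)) t).comp (prTail (k + 1)) := fun t => by
      rw [← Fin.succ_last, prTail_comp_face_succ]
    refine ⟨(side O p b).comp (prTail (k + 2)), fun x => side_mem h _ _, ?_, fun i e he => ?_,
      fun _ x => ?_⟩
    · rw [ContinuousMap.comp_assoc, hl, ← ContinuousMap.comp_assoc, side_comp_face_last_zero h hb]
    · induction i using Fin.cases with
      | zero =>
        rw [Fin.castSucc_zero', ContinuousMap.comp_assoc, prTail_comp_face_zero,
          ContinuousMap.comp_assoc, prTail_comp_face_zero, ContinuousMap.comp_id,
          ContinuousMap.comp_id]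
      | succ i =>
        rw [← Fin.succ_castSucc, ContinuousMap.comp_assoc, prTail_comp_face_succ,
          ContinuousMap.comp_assoc, prTail_comp_face_succ, ← ContinuousMap.comp_assoc,
          ← ContinuousMap.comp_assoc, side_comp_prTail, side_comp_face_castSucc h _ _ he]
    · rw [← ContinuousMap.comp_apply, ContinuousMap.comp_assoc, hl, ← ContinuousMap.comp_assoc,
        side_comp_face_last_one h hp]
      rfl
  · obtain ⟨M, hM, hb, hs⟩ := kan (O := O) c (fun i e => side O p (c.comp (face i e))) hc
      (fun i e he x => side_mem h _ _)
      (fun i e he => side_comp_face_last_zero h fun x => hc _)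
      (fun t => compat_natural c (fun d => (side O p d).comp (face (Fin.last _) t))
        (fun d => (side O p d).comp (face (Fin.last _) t)) fun i j e e' he he' => by
          rw [← side_comp_face_castSucc h _ _ he', comp_face_castSucc_comp_face_last])
    exact ⟨M, hM, hb, hs, fun hd' => absurd hd' hd⟩

lemma isPrism_prism (h : ∀ j ≤ k + 2, HE j O) (hp : p ∈ O) {c : C(Cb (k + 2), E)}
    (hc : ∀ x, c x ∈ O) : IsPrism O p c (prism O p c) := by
  rw [prism, dif_pos (exists_isPrism h hp hc)]
  exact (exists_isPrism h hp hc).choose_spec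

lemma top_mem (h : ∀ j ≤ k + 2, HE j O) (hp : p ∈ O) {c : C(Cb (k + 2), E)}
    (hc : ∀ x, c x ∈ O) (x : Cb (k + 2)) : top O p c x ∈ O := (isPrism_prism h hp hc).mem _

lemma top_of_mem_boundary (h : ∀ j ≤ k + 2, HE j O) (hp : p ∈ O) {c : C(Cb (k + 2), E)}
    (hc : ∀ x, c x ∈ O) {x : Cb (k + 2)} (hx : x ∈ Cube.boundary (Fin (k + 2))) :
    top O p c x = p := by
  obtain ⟨i, e, y, he, rfl⟩ := exists_face_of_mem_boundary hx
  rw [← ContinuousMap.comp_apply, top, ← comp_face_castSucc_comp_face_last,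
    (isPrism_prism h hp hc).sides i e he,
    side_comp_face_last_one (fun j hj => h j (by omega)) hp]
  rfl

lemma compat_prism (h : ∀ j ≤ k + 2, HE j O) (hp : p ∈ O) {F : C(Cb (k + 3), E)}
    (hF : ∀ i e, (e = 0 ∨ e = 1) → ∀ x, F (face i e x) ∈ O) (t : I) :
    Compat (fun _ _ => True) fun i e =>
      (prism O p (F.comp (face i e))).comp (face (Fin.last (k + 2)) t) :=
  compat_natural F (fun d => (prism O p d).comp (face (Fin.last _) t))
    (fun d => (side O p d).comp (face (Fin.last _) t)) fun i j e e' he he' => by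
      rw [← (isPrism_prism h hp (hF i e he)).sides j e' he', comp_face_castSucc_comp_face_last]

end

lemma exists_face_of_codim2 {k : ℕ} {x : Cb (k + 1)} (hx : Codim2 x) :
    ∃ i e y, (e = 0 ∨ e = 1) ∧ y ∈ Cube.boundary (Fin k) ∧ x = face i e y := by
  obtain ⟨i, j, hij, hi, hj⟩ := hx
  obtain ⟨j, rfl⟩ := Fin.exists_succAbove_eq hij.symm
  exact ⟨i, x i, i.removeNth x, hi, ⟨j, hj⟩, by simp⟩

/-- Forgetting the last coordinate. -/
def initMap (k : ℕ) : C(Cb (k + 1), Cb k) :=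
  ⟨fun x => Fin.init x, continuous_pi fun i => continuous_apply i.castSucc⟩

lemma initMap_comp_face_last {k : ℕ} (t : I) :
    (initMap k).comp (face (Fin.last k) t) = ContinuousMap.id _ := by
  ext x; simp [initMap, Fin.insertNth_last']

section

variable {E : Type} [TopologicalSpace E] {k : ℕ} [Nontrivial (Fin k)] {O : Set E} {p : E}

open Classical in
/-- The element of the homotopy group of `O` represented by a cube in `O`. -/
def clO (hp : p ∈ O) (c : C(Cb k, E)) : Additive (HomotopyGroup (Fin k) O ⟨p, hp⟩) :=
  if h : ∀ x, c x ∈ O then cl (X := O) ⟨p, hp⟩ ⟨fun x => ⟨c x, h x⟩, by fun_prop⟩ else 0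

lemma clO_of_const (hp : p ∈ O) {c : C(Cb k, E)} (hc : ∀ x, c x = p) : clO hp c = 0 := by
  rw [clO, dif_pos fun x => by rw [hc x]; exact hp]
  exact cl_of_const fun x => Subtype.ext (hc x)

lemma sum_clO_eq_zero (hp : p ∈ O) {T : C(Cb (k + 1), E)} (hT : ∀ x, T x ∈ O)
    (hc : ∀ x, Codim2 x → T x = p) :
    ∑ i : Fin (k + 1), (-1 : ℤ) ^ (i : ℕ) •
      (clO hp (T.comp (face i 1)) - clO hp (T.comp (face i 0))) = 0 := by
  rw [← faceSum_eq_zero (p := (⟨p, hp⟩ : O))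
    (⟨fun x => ⟨T x, hT x⟩, by fun_prop⟩ : C(Cb (k + 1), O))
    fun x hx => Subtype.ext (hc x hx), faceSum]
  refine Finset.sum_congr rfl fun i _ => ?_
  have h : ∀ e, clO hp (T.comp (face i e)) = cl (X := O) ⟨p, hp⟩
      ((⟨fun x => ⟨T x, hT x⟩, by fun_prop⟩ : C(Cb (k + 1), O)).comp (face i e)) :=
    fun e => dif_pos fun x => hT _
  rw [h, h]

lemma exists_homotopy_of_clO_eq (hp : p ∈ O) {g g' : C(Cb k, E)} (hg : ∀ x, g x ∈ O)
    (hg' : ∀ x, g' x ∈ O) (hb : ∀ y ∈ Cube.boundary (Fin k), g y = p)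
    (hb' : ∀ y ∈ Cube.boundary (Fin k), g' y = p) (h : clO hp g = clO hp g') :
    ∃ Θ : C(Cb (k + 1), E), (∀ x, Θ x ∈ O) ∧ Θ.comp (face (Fin.last k) 0) = g ∧
      Θ.comp (face (Fin.last k) 1) = g' ∧
      ∀ t, ∀ x ∈ Cube.boundary (Fin k), Θ (face (Fin.last k) t x) = p := by
  rw [clO, clO, dif_pos hg, dif_pos hg'] at h
  obtain ⟨F, h0, h1, hF⟩ := exists_homotopy_of_cl_eq (fun y hy => Subtype.ext (hb y hy))
    (fun y hy => Subtype.ext (hb' y hy)) h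
  have hl : ∀ (t : I) (x : Cb k), (face (Fin.last k) t x (Fin.last k),
      initMap k (face (Fin.last k) t x)) = (t, x) := fun t x => by
    rw [← ContinuousMap.comp_apply, initMap_comp_face_last]
    simp
  refine ⟨⟨fun x => F (x (Fin.last k), initMap k x), by fun_prop⟩, fun x => (F _).2, ?_, ?_,
    fun t x hx => ?_⟩
  · ext x
    rw [ContinuousMap.comp_apply, ContinuousMap.coe_mk, hl, h0]
    rfl
  · ext x
    rw [ContinuousMap.comp_apply, ContinuousMap.coe_mk, hl, h1]
    rfl
  · rw [ContinuousMap.coe_mk, hl, hF t x hx]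

end

section

variable {E : Type} [NormedAddCommGroup E] [NormedSpace ℝ E] {l : ℕ} {O : Set E} {p : E}

open Classical in
/-- The class of the top face of the prism over a cube in `O`. -/
def topCl (hp : p ∈ O) (c : C(Cb (l + 2), E)) :
    Additive (HomotopyGroup (Fin (l + 2)) O ⟨p, hp⟩) :=
  if ∀ x, c x ∈ O then clO hp (top O p c) else 0

lemma topCl_of_mem (hp : p ∈ O) {c : C(Cb (l + 2), E)} (hc : ∀ x, c x ∈ O) :
    topCl hp c = clO hp (top O p c) := if_pos hc

variable [TietzeExtension.{0} E]

lemma topCl_of_isDeg (h : ∀ j ≤ l + 2, HE j O) (hp : p ∈ O) {c : C(Cb (l + 2), E)}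
    (hc : IsDeg c) : topCl hp c = 0 := by
  rw [topCl]
  split_ifs with hO
  · exact clO_of_const hp fun x => (isPrism_prism h hp hO).deg hc x
  · rfl

lemma lift_topCl_bdCube (h : ∀ j ≤ l + 2, HE j O) (hp : p ∈ O) {F : C(Cb (l + 3), E)}
    (hF : ∀ i e, (e = 0 ∨ e = 1) → ∀ x, F (face i e x) ∈ O) :
    lift (topCl hp) (bdCube F) = ∑ i : Fin (l + 3), (-1 : ℤ) ^ (i : ℕ) •
      (clO hp (top O p (F.comp (face i 1))) - clO hp (top O p (F.comp (face i 0)))) := by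
  rw [bdCube, map_sum]
  refine Finset.sum_congr rfl fun i _ => ?_
  rw [map_zsmul, map_sub, lift_cls fun c hc => topCl_of_isDeg h hp hc,
    lift_cls fun c hc => topCl_of_isDeg h hp hc, topCl_of_mem hp (hF i 1 (Or.inr rfl)),
    topCl_of_mem hp (hF i 0 (Or.inl rfl))]

lemma eq_of_codim2 (h : ∀ j ≤ l + 2, HE j O) (hp : p ∈ O) {F T : C(Cb (l + 3), E)}
    (hF : ∀ i e, (e = 0 ∨ e = 1) → ∀ x, F (face i e x) ∈ O)
    (hT : ∀ i e, (e = 0 ∨ e = 1) → T.comp (face i e) = top O p (F.comp (face i e)))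
    {x : Cb (l + 3)} (hx : Codim2 x) : T x = p := by
  obtain ⟨i, e, y, he, hy, rfl⟩ := exists_face_of_codim2 hx
  rw [← ContinuousMap.comp_apply, hT i e he, top_of_mem_boundary h hp (hF i e he) hy]

lemma lift_topCl_bdCube_of_mem (h : ∀ j ≤ l + 2, HE j O) (hp : p ∈ O) {G : C(Cb (l + 3), E)}
    (hG : ∀ x, G x ∈ O) : lift (topCl hp) (bdCube G) = 0 := by
  have hF : ∀ i e, (e = 0 ∨ e = 1) → ∀ x, G (face i e x) ∈ O := fun i e he x => hG _
  obtain ⟨M, hM, -, hs⟩ := kan (O := O) G (fun i e => prism O p (G.comp (face i e))) hG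
    (fun i e he => (isPrism_prism h hp (hF i e he)).mem)
    (fun i e he => (isPrism_prism h hp (hF i e he)).bot) (compat_prism h hp hF)
  have hT : ∀ i e, (e = 0 ∨ e = 1) →
      (M.comp (face (Fin.last _) 1)).comp (face i e) = top O p (G.comp (face i e)) :=
    fun i e he => by rw [← comp_face_castSucc_comp_face_last, hs i e he, top]
  rw [lift_topCl_bdCube h hp hF, ← sum_clO_eq_zero hp (T := M.comp (face (Fin.last _) 1))
    (fun x => hM _) fun x hx => eq_of_codim2 h hp hF hT hx]
  refine Finset.sum_congr rfl fun i _ => ?_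
  rw [hT i 1 (Or.inr rfl), hT i 0 (Or.inl rfl)]

end

section

variable {E : Type} [TopologicalSpace E] {k : ℕ} {O : Set E}

lemma comp_boxRetract_mem {F : C(Cb (k + 1), E)}
    (hF : ∀ i e, (e = 0 ∨ e = 1) → ∀ x, F (face i e x) ∈ O) (x : Cb (k + 1)) :
    F.comp boxRetract x ∈ O := by
  have hbox : ∀ x ∈ box k, F x ∈ O := by
    rintro x (hx | ⟨j, hj⟩)
    · have := hF (Fin.last _) (x (Fin.last _)) (Or.inl hx) (Fin.init x)
      rwa [face_last_init] at this
    · have := hF j.castSucc (x j.castSucc) hj (j.castSucc.removeNth x)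
      simpa using this
  exact hbox _ (boxRetract_mem x)

lemma comp_boxRetract_comp_face_castSucc (F : C(Cb (k + 2), E)) (i : Fin (k + 1)) {e : I}
    (he : e = 0 ∨ e = 1) :
    (F.comp boxRetract).comp (face i.castSucc e) = F.comp (face i.castSucc e) := by
  ext x
  exact congrArg F (boxRetract_of_mem (mem_box_face_castSucc i he x))

lemma comp_boxRetract_comp_face_last_zero (F : C(Cb (k + 1), E)) :
    (F.comp boxRetract).comp (face (Fin.last k) 0) = F.comp (face (Fin.last k) 0) := by
  ext x
  exact congrArg F (boxRetract_of_mem (mem_box_face_last_zero x))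

end

section

variable {E : Type} [NormedAddCommGroup E] [TietzeExtension.{0} E] {k l : ℕ} {O : Set E} {p : E}

/-- A cube with boundary in `O` can be replaced by a cube in `O`, if its last face is homotopic in
`O` to the last face of the cube obtained by filling the other faces. -/
lemma exists_filler_of_homotopy {F Θ : C(Cb (k + 2), E)}
    (hF : ∀ i e, (e = 0 ∨ e = 1) → ∀ x, F (face i e x) ∈ O) (hΘO : ∀ x, Θ x ∈ O)
    (hΘ0 : Θ.comp (face (Fin.last _) 0) = (F.comp boxRetract).comp (face (Fin.last _) 1))
    (hΘ1 : Θ.comp (face (Fin.last _) 1) = F.comp (face (Fin.last _) 1))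
    (hΘ : ∀ t, ∀ x ∈ Cube.boundary (Fin (k + 1)),
      Θ (face (Fin.last _) t x) = F (face (Fin.last _) 1 x)) :
    ∃ G : C(Cb (k + 2), E), (∀ x, G x ∈ O) ∧
      ∀ i e, (e = 0 ∨ e = 1) → G.comp (face i e) = F.comp (face i e) := by
  classical
  let Φ : Fin (k + 2) → I → C(Cb (k + 2), E) := fun i e =>
    if i = Fin.last _ ∧ e = 1 then Θ else (F.comp (face i e)).comp (initMap _)
  have hΦ1 : Φ (Fin.last _) 1 = Θ := if_pos ⟨rfl, rfl⟩
  have hΦ2 : ∀ i e, ¬ (i = Fin.last _ ∧ e = 1) → ∀ t,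
      (Φ i e).comp (face (Fin.last _) t) = F.comp (face i e) := fun i e hie t => by
    rw [show Φ i e = (F.comp (face i e)).comp (initMap _) from if_neg hie,
      ContinuousMap.comp_assoc, initMap_comp_face_last, ContinuousMap.comp_id]
  have mixed : ∀ t i e x x', (e = 0 ∨ e = 1) → ¬ (i = Fin.last _ ∧ e = 1) →
      face (Fin.last (k + 1)) 1 x = face i e x' →
      Θ (face (Fin.last _) t x) = F (face i e x') := by
    intro t i e x x' he hie hx
    have hxb : x ∈ Cube.boundary (Fin (k + 1)) := by
      induction i using Fin.lastCases with
      | last => exact absurd ⟨rfl, (eq_of_face_eq hx).1.symm⟩ hie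
      | cast j =>
        have := congrFun hx j.castSucc
        simp only [face_apply, Fin.insertNth_apply_same, Fin.insertNth_last',
          Fin.snoc_castSucc] at this
        exact ⟨j, this ▸ he⟩
    rw [hΘ t x hxb, ← hx]
  obtain ⟨M, hM, -, hMs⟩ := kan (O := O) (F.comp boxRetract) Φ (comp_boxRetract_mem hF)
    (fun i e he x => by
      by_cases hie : i = Fin.last _ ∧ e = 1
      · obtain ⟨rfl, rfl⟩ := hie
        rw [hΦ1]
        exact hΘO x
      · rw [show Φ i e = (F.comp (face i e)).comp (initMap _) from if_neg hie]
        exact hF i e he _)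
    (fun i e he => by
      by_cases hie : i = Fin.last _ ∧ e = 1
      · obtain ⟨rfl, rfl⟩ := hie
        rw [hΦ1, hΘ0]
      · rw [hΦ2 i e hie]
        induction i using Fin.lastCases with
        | last =>
          obtain rfl : e = 0 := he.resolve_right fun h => hie ⟨rfl, h⟩
          exact (comp_boxRetract_comp_face_last_zero F).symm
        | cast i => exact (comp_boxRetract_comp_face_castSucc F i he).symm)
    (fun t i i' e e' he he' _ _ x x' hx => by
      by_cases hie : i = Fin.last _ ∧ e = 1 <;> by_cases hie' : i' = Fin.last _ ∧ e' = 1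
      · obtain ⟨rfl, rfl⟩ := hie
        obtain ⟨rfl, rfl⟩ := hie'
        rw [face_injective _ _ hx]
      · obtain ⟨rfl, rfl⟩ := hie
        simp only [hΦ2 i' e' hie', hΦ1]
        exact mixed t i' e' x x' he' hie' hx
      · obtain ⟨rfl, rfl⟩ := hie'
        simp only [hΦ2 i e hie, hΦ1]
        exact (mixed t i e x' x he hie hx.symm).symm
      · simp only [hΦ2 i e hie, hΦ2 i' e' hie']
        exact congrArg F hx)
  refine ⟨M.comp (face (Fin.last _) 1), fun x => hM _, fun i e he => ?_⟩
  rw [← comp_face_castSucc_comp_face_last, hMs i e he]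
  by_cases hie : i = Fin.last _ ∧ e = 1
  · obtain ⟨rfl, rfl⟩ := hie
    rw [hΦ1, hΘ1]
  · rw [hΦ2 i e hie]

lemma HE.of_simplyConnected (h : SimplyConnectedSpace O) : HE 0 O ∧ HE 1 O ∧ HE 2 O := by
  have hpc : IsPathConnected O := isPathConnected_iff_pathConnectedSpace.2 inferInstance
  refine ⟨fun F _ => ?_, fun F hF => ?_, fun F hFb => ?_⟩
  · obtain ⟨p, hp⟩ := hpc.nonempty
    exact ⟨ContinuousMap.const _ p, fun _ => hp, fun x ⟨i, _⟩ => i.elim0⟩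
  · obtain ⟨γ, hγ⟩ := hpc.joinedIn (F 0) (hF _ ⟨0, Or.inl rfl⟩) (F 1) (hF _ ⟨0, Or.inr rfl⟩)
    refine ⟨⟨fun x => γ (x 0), by fun_prop⟩, fun x => hγ _, ?_⟩
    rintro x ⟨i, hi | hi⟩ <;> obtain rfl : i = 0 := Subsingleton.elim _ _
    · rw [show x = 0 from funext fun i => by rw [Subsingleton.elim i 0, hi]; rfl]
      exact γ.source
    · rw [show x = 1 from funext fun i => by rw [Subsingleton.elim i 0, hi]; rfl]
      exact γ.target
  · have hF : ∀ i e, (e = 0 ∨ e = 1) → ∀ x, F (face i e x) ∈ O := fun i e he x =>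
      hFb _ (face_mem_boundary i he x)
    have hl0 : ∀ (t : I) (x : Cb 1), face (Fin.last 1) t x 0 = x 0 := fun t x => by
      rw [← Fin.castSucc_zero, face_apply, Fin.insertNth_last', Fin.snoc_castSucc]
    have hl1 : ∀ (t : I) (x : Cb 1), face (Fin.last 1) t x 1 = t := fun t x =>
      Fin.insertNth_apply_same (α := fun _ => I) (Fin.last 1) t x
    have hv : ∀ x : Cb 1, (fun _ => x 0) = x := fun x => funext fun i => by
      rw [Subsingleton.elim i 0]
    have hbd : ∀ s : I, (s = 0 ∨ s = 1) →
        F.comp boxRetract (face (Fin.last 1) 1 fun _ => s) = F (face (Fin.last 1) 1 fun _ => s) :=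
      fun s hs => congrArg F (boxRetract_of_mem (Or.inr ⟨0, by rwa [Fin.castSucc_zero, hl0]⟩))
    let γ (T : C(Cb 2, E)) (hT : ∀ s : I, T (face (Fin.last 1) 1 fun _ => s) ∈ O) : C(I, O) :=
      ⟨fun s => ⟨T (face (Fin.last 1) 1 fun _ => s), hT s⟩, by fun_prop⟩
    let γ₀ : Path (γ F (fun s => hF _ _ (Or.inr rfl) _) 0)
        (γ F (fun s => hF _ _ (Or.inr rfl) _) 1) :=
      ⟨γ (F.comp boxRetract) fun s => comp_boxRetract_mem hF _,
        Subtype.ext (hbd 0 (Or.inl rfl)), Subtype.ext (hbd 1 (Or.inr rfl))⟩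
    let γ₁ : Path (γ F (fun s => hF _ _ (Or.inr rfl) _) 0)
        (γ F (fun s => hF _ _ (Or.inr rfl) _) 1) :=
      ⟨γ F fun s => hF _ _ (Or.inr rfl) _, rfl, rfl⟩
    obtain ⟨K⟩ := SimplyConnectedSpace.paths_homotopic γ₀ γ₁
    obtain ⟨G, hG, hGF⟩ := exists_filler_of_homotopy (k := 0) (F := F) (O := O)
      (Θ := ⟨fun x => K (x 1, x 0), by fun_prop⟩) hF (fun x => (K _).2)
      (ContinuousMap.ext fun x => by
        change (K (face (Fin.last 1) 0 x 1, face (Fin.last 1) 0 x 0) : E) = _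
        rw [hl0, hl1, K.apply_zero]
        exact congrArg (fun y => F (boxRetract (face (Fin.last 1) 1 y))) (hv x))
      (ContinuousMap.ext fun x => by
        change (K (face (Fin.last 1) 1 x 1, face (Fin.last 1) 1 x 0) : E) = _
        rw [hl0, hl1, K.apply_one]
        exact congrArg (fun y => F (face (Fin.last 1) 1 y)) (hv x))
      (by
        rintro t x ⟨i, hi⟩
        obtain rfl : i = 0 := Fin.ext (by omega)
        change (K (face (Fin.last 1) t x 1, face (Fin.last 1) t x 0) : E) = _
        rw [hl0, hl1, ← hv x]
        rcases hi with hi | hi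
        · rw [hi, K.source]
          rfl
        · rw [hi, K.target]
          rfl)
    refine ⟨G, hG, fun x hx => ?_⟩
    obtain ⟨i, e, y, he, rfl⟩ := exists_face_of_mem_boundary hx
    exact DFunLike.congr_fun (hGF i e he) y

/-- A cube whose codimension two skeleton is mapped to a point and whose boundary is
homotopically trivial in `O` can be replaced by a cube in `O`. -/
lemma exists_filler_of_sum_eq_zero (hp : p ∈ O) {F : C(Cb (l + 3), E)}
    (hF : ∀ i e, (e = 0 ∨ e = 1) → ∀ x, F (face i e x) ∈ O)
    (hc : ∀ x, Codim2 x → F x = p)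
    (hs : ∑ i : Fin (l + 3), (-1 : ℤ) ^ (i : ℕ) •
      (clO hp (F.comp (face i 1)) - clO hp (F.comp (face i 0))) = 0) :
    ∃ G : C(Cb (l + 3), E), (∀ x, G x ∈ O) ∧
      ∀ i e, (e = 0 ∨ e = 1) → G.comp (face i e) = F.comp (face i e) := by
  set G := F.comp (boxRetract (k := l + 2)) with hG
  have hGO : ∀ x, G x ∈ O := comp_boxRetract_mem hF
  have hbd : ∀ x : Cb (l + 3), Codim2 x → x ∈ box (l + 2) := by
    rintro x ⟨i, j, hij, hi, hj⟩
    induction i using Fin.lastCases with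
    | last =>
      induction j using Fin.lastCases with
      | last => exact absurd rfl hij
      | cast j => exact Or.inr ⟨j, hj⟩
    | cast i => exact Or.inr ⟨i, hi⟩
  have hGp : ∀ x, Codim2 x → G x = p := fun x hx => by
    rw [← hc x hx, hG, ContinuousMap.comp_apply, boxRetract_of_mem (hbd x hx)]
  have hcl : clO hp (G.comp (face (Fin.last _) 1)) = clO hp (F.comp (face (Fin.last _) 1)) := by
    have h1 := sum_clO_eq_zero hp hGO hGp
    rw [← hs, Fin.sum_univ_castSucc, Fin.sum_univ_castSucc (n := l + 2),
      comp_boxRetract_comp_face_last_zero,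
      Finset.sum_congr rfl fun i _ => by
        rw [comp_boxRetract_comp_face_castSucc F i (Or.inr rfl),
          comp_boxRetract_comp_face_castSucc F i (Or.inl rfl)]] at h1
    have h2 := add_left_cancel h1
    rcases neg_one_pow_eq_or ℤ ((Fin.last (l + 2) : Fin (l + 3)) : ℕ) with h3 | h3
    · rw [h3, one_smul, one_smul] at h2
      exact sub_left_injective h2
    · rw [h3, neg_smul, neg_smul, one_smul, one_smul, neg_inj] at h2
      exact sub_left_injective h2
  obtain ⟨Θ, hΘO, hΘ0, hΘ1, hΘ⟩ := exists_homotopy_of_clO_eq hp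
    (g := G.comp (face (Fin.last _) 1)) (g' := F.comp (face (Fin.last _) 1)) (fun x => hGO _)
    (fun x => hF _ _ (Or.inr rfl) x) (fun y hy => hGp _ (codim2_face _ (Or.inr rfl) hy))
    (fun y hy => hc _ (codim2_face _ (Or.inr rfl) hy)) hcl
  exact exists_filler_of_homotopy hF hΘO hΘ0 hΘ1 fun t x hx => by
    rw [hΘ t x hx, hc _ (codim2_face _ (Or.inr rfl) hx)]

end

section

variable {E : Type} [NormedAddCommGroup E] [NormedSpace ℝ E] [TietzeExtension.{0} E] {l : ℕ}
  {O : Set E}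

/-- The inductive step of the Hurewicz theorem. -/
lemma HE.step (h : ∀ j ≤ l + 2, HE j O) (hv : Van (l + 1) O) : HE (l + 3) O := by
  intro F hFb
  have hF : ∀ i e, (e = 0 ∨ e = 1) → ∀ x, F (face i e x) ∈ O := fun i e he x =>
    hFb _ (face_mem_boundary i he x)
  obtain ⟨p, hp⟩ : ∃ p : E, p ∈ O := ⟨_, hF 0 0 (Or.inl rfl) 0⟩
  have hsum : lift (topCl hp) (bdCube F) = 0 := by
    obtain ⟨w, hw, hwz⟩ := hv (bdCube F)
      (sum_mem fun i _ => Submodule.smul_mem _ _ (sub_mem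
        (cls_mem_NA (hF i 1 (Or.inr rfl))) (cls_mem_NA (hF i 0 (Or.inl rfl)))))
      (by rw [← bd_cls, bd_bd])
    have hle : NA (l + 3) O ≤ LinearMap.ker ((lift (topCl hp)).comp bd) := NA_le fun c hc => by
      rw [LinearMap.mem_ker, LinearMap.comp_apply, bd_cls, lift_topCl_bdCube_of_mem h hp hc]
    rw [← hwz]
    exact hle hw
  rw [lift_topCl_bdCube h hp hF] at hsum
  have hct : Compat (fun _ _ => True) fun i e => top O p (F.comp (face i e)) :=
    compat_prism h hp hF 1
  obtain ⟨F', hF'⟩ := hct.exists_glue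
  have hF't : ∀ i e, (e = 0 ∨ e = 1) → F'.comp (face i e) = top O p (F.comp (face i e)) :=
    fun i e he => hF' i e he trivial
  obtain ⟨G, hG, hGf⟩ := exists_filler_of_sum_eq_zero hp (F := F')
    (fun i e he x => by
      rw [← ContinuousMap.comp_apply, hF't i e he]
      exact top_mem h hp (hF i e he) x)
    (fun x hx => eq_of_codim2 h hp hF hF't hx)
    (by
      rw [← hsum]
      refine Finset.sum_congr rfl fun i _ => ?_
      rw [hF't i 1 (Or.inr rfl), hF't i 0 (Or.inl rfl)])
  obtain ⟨M, hM, -, hMs⟩ := kan' (O := O) G (fun i e => prism O p (F.comp (face i e))) hG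
    (fun i e he => (isPrism_prism h hp (hF i e he)).mem)
    (fun i e he => by rw [hGf i e he, hF't i e he, top]) (compat_prism h hp hF)
  refine ⟨M.comp (face (Fin.last _) 0), fun x => hM _, fun x hx => ?_⟩
  obtain ⟨i, e, y, he, rfl⟩ := exists_face_of_mem_boundary hx
  have key : (M.comp (face (Fin.last _) 0)).comp (face i e) = F.comp (face i e) := by
    rw [← comp_face_castSucc_comp_face_last, hMs i e he, (isPrism_prism h hp (hF i e he)).bot]
  exact DFunLike.congr_fun key y

theorem HE.of_van (h : SimplyConnectedSpace O) (hv : ∀ l, Van (l + 1) O) (j : ℕ) : HE j O := by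
  obtain ⟨h0, h1, h2⟩ := HE.of_simplyConnected h
  induction j using Nat.strong_induction_on with
  | _ j ih =>
    match j with
    | 0 => exact h0
    | 1 => exact h1
    | 2 => exact h2
    | l + 3 => exact HE.step (fun j hj => ih j (by omega)) (hv l)

end

/-- The unit cube of the integral grid with a given corner. -/
def shift {n : ℕ} (a : Fin n → ℤ) : C(Cb n, Fin n → ℝ) :=
  ⟨fun x i => a i + x i, by fun_prop⟩

/-- The coordinates of a point in a cube of the grid. -/
def localCoord {n : ℕ} (a : Fin n → ℤ) (x : Fin n → ℝ) : Cb n :=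
  fun i => projIcc 0 1 zero_le_one (x i - a i)

lemma continuous_localCoord {n : ℕ} (a : Fin n → ℤ) : Continuous (localCoord a) :=
  continuous_pi fun i => continuous_projIcc.comp (by fun_prop)

lemma shift_localCoord {n : ℕ} {a : Fin n → ℤ} {x : Fin n → ℝ}
    (hx : x ∈ pi univ fun i => Icc (a i : ℝ) (a i + 1)) : shift a (localCoord a x) = x := by
  ext i
  have := hx i (mem_univ i)
  have h : x i - a i ∈ Icc (0 : ℝ) 1 := ⟨by linarith [this.1], by linarith [this.2]⟩
  simp [shift, localCoord, projIcc_of_mem _ h]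

lemma shift_update_comp_face {k : ℕ} (a : Fin (k + 1) → ℤ) (i : Fin (k + 1)) :
    (shift (Function.update a i (a i + 1))).comp (face i 0) = (shift a).comp (face i 1) := by
  ext z j
  rcases Fin.eq_self_or_eq_succAbove i j with rfl | ⟨j, rfl⟩ <;> simp [shift]

lemma locallyFinite_cells (n : ℕ) :
    LocallyFinite fun a : Fin n → ℤ => pi univ fun i => Icc (a i : ℝ) (a i + 1) := by
  intro x
  refine ⟨ball x 1, ball_mem_nhds x one_pos,
    (Set.Finite.pi' fun i => Set.finite_Icc ⌊x i - 2⌋ ⌈x i + 1⌉).subset ?_⟩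
  rintro a ⟨y, hy, hyx⟩ i
  have h1 := hy i (mem_univ i)
  have h2 := abs_lt.1 ((Real.dist_eq _ _).symm.trans_lt ((dist_le_pi_dist y x i).trans_lt hyx))
  constructor
  · exact Int.floor_le_iff.2 (by linarith [h1.2, h2.1])
  · exact Int.le_ceil_iff.2 (by linarith [h1.1, h2.2])

section

variable {E : Type} [TopologicalSpace E] [TietzeExtension.{0} E] {n : ℕ} {O : Set E}

lemma repl_shift_eq (h : ∀ j ≤ n, HE j O) (G : C(Fin n → ℝ, E)) {a b : Fin n → ℤ} {x y : Cb n}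
    (hxy : shift a x = shift b y) :
    repl O n (G.comp (shift a)) x = repl O n (G.comp (shift b)) y := by
  have hi : ∀ {a : Fin n → ℤ} {x : Cb n}, shift a x = shift b y → ∀ i,
      (a i = b i ∧ x i = y i) ∨ (a i = b i + 1 ∧ x i = 0 ∧ y i = 1) ∨
      (b i = a i + 1 ∧ x i = 1 ∧ y i = 0) := by
    intro a x hxy i
    have h1 : (a i : ℝ) + x i = b i + y i := congrFun hxy i
    have hx := (x i).2
    have hy := (y i).2
    have h2 : a i ≤ b i + 1 := by
      exact_mod_cast (by linarith [hx.1, hy.2] : (a i : ℝ) ≤ b i + 1)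
    have h3 : b i ≤ a i + 1 := by
      exact_mod_cast (by linarith [hx.2, hy.1] : (b i : ℝ) ≤ a i + 1)
    obtain h4 | h4 | h4 : a i = b i ∨ a i = b i + 1 ∨ b i = a i + 1 := by omega
    · refine Or.inl ⟨h4, Subtype.ext ?_⟩
      rw [h4] at h1
      linarith
    · have h5 : (a i : ℝ) = b i + 1 := by exact_mod_cast h4
      exact Or.inr (Or.inl ⟨h4, Subtype.ext (by change (x i : ℝ) = 0; linarith [hy.2, hx.1]),
        Subtype.ext (by change (y i : ℝ) = 1; linarith [hy.2, hx.1])⟩)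
    · have h5 : (b i : ℝ) = a i + 1 := by exact_mod_cast h4
      exact Or.inr (Or.inr ⟨h4, Subtype.ext (by change (x i : ℝ) = 1; linarith [hx.2, hy.1]),
        Subtype.ext (by change (y i : ℝ) = 0; linarith [hx.2, hy.1])⟩)
  cases n with
  | zero => rw [Subsingleton.elim a b, Subsingleton.elim x y]
  | succ k =>
    have step : ∀ (a : Fin (k + 1) → ℤ) i z,
        repl O (k + 1) (G.comp (shift (Function.update a i (a i + 1)))) (face i 0 z) =
          repl O (k + 1) (G.comp (shift a)) (face i 1 z) := fun a i z => by
      rw [← ContinuousMap.comp_apply, ← ContinuousMap.comp_apply,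
        repl_comp_face h _ _ (Or.inl rfl), repl_comp_face h _ _ (Or.inr rfl),
        ContinuousMap.comp_assoc, ContinuousMap.comp_assoc, shift_update_comp_face]
    have hface : ∀ (x : Cb (k + 1)) i e, x i = e → ∃ z, x = face i e z := fun x i e he =>
      ⟨i.removeNth x, by simp [← he]⟩
    have key : ∀ (s : Finset (Fin (k + 1))) (a : Fin (k + 1) → ℤ) (x : Cb (k + 1)),
        (∀ i ∉ s, a i = b i) → shift a x = shift b y →
        repl O (k + 1) (G.comp (shift a)) x = repl O (k + 1) (G.comp (shift b)) y := by
      intro s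
      induction s using Finset.induction_on with
      | empty =>
        intro a x hab hxy
        obtain rfl : a = b := funext fun i => hab i (Finset.notMem_empty i)
        congr 1
        funext i
        rcases hi hxy i with h | h | h
        · exact h.2
        · omega
        · omega
      | insert i s his ih =>
        intro a x hab hxy
        have hab' : ∀ c : ℤ, c = b i → ∀ j ∉ s, Function.update a i c j = b j := by
          intro c hc j hj
          by_cases hji : j = i
          · rw [hji, Function.update_self, hc]
          · rw [Function.update_of_ne hji, hab j fun h =>
              (Finset.mem_insert.1 h).elim hji hj]
        rcases hi hxy i with h1 | ⟨h1, h2, -⟩ | ⟨h1, h2, -⟩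
        · refine ih a x (fun j hj => ?_) hxy
          rw [← hab' (a i) h1.1 j hj, Function.update_eq_self]
        · obtain ⟨z, rfl⟩ := hface x i 0 h2
          have ha : a = Function.update (Function.update a i (b i)) i
              (Function.update a i (b i) i + 1) := by
            rw [Function.update_self, Function.update_idem, ← h1, Function.update_eq_self]
          rw [← ih _ (face i 1 z) (hab' _ rfl), ← step, ← ha]
          rw [← hxy, ← ContinuousMap.comp_apply, ← shift_update_comp_face, ← ha]
          rfl
        · obtain ⟨z, rfl⟩ := hface x i 1 h2
          rw [← step, ih _ _ (hab' _ h1.symm)]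
          rw [← hxy, ← ContinuousMap.comp_apply, shift_update_comp_face]
          rfl
    exact key Finset.univ a x (fun i hi => absurd (Finset.mem_univ i) hi) hxy

lemma exists_extension_of_unit_thickening (h : ∀ j ≤ n, HE j O) (G : C(Fin n → ℝ, E))
    {A : Set (Fin n → ℝ)} (hA : ∀ x ∈ A, ∀ y, dist x y ≤ 1 → G y ∈ O) :
    ∃ G' : C(Fin n → ℝ, E), (∀ x, G' x ∈ O) ∧ ∀ x ∈ A, G' x = G x := by
  let g : (Fin n → ℝ) → E := fun x =>
    repl O n (G.comp (shift fun i => ⌊x i⌋)) (localCoord (fun i => ⌊x i⌋) x)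
  have hfl : ∀ x : Fin n → ℝ, x ∈ pi univ fun i => Icc ((⌊x i⌋ : ℤ) : ℝ) (⌊x i⌋ + 1) :=
    fun x i _ => ⟨Int.floor_le _, (Int.lt_floor_add_one _).le⟩
  have hg : Continuous g := by
    refine (locallyFinite_cells n).continuous (iUnion_eq_univ_iff.2 fun x => ⟨_, hfl x⟩)
      (fun a => isClosed_set_pi fun i _ => isClosed_Icc) fun a => ?_
    refine ((ContinuousMap.continuous (repl O n (G.comp (shift a)))).comp
      (continuous_localCoord a)).continuousOn.congr fun x hx => ?_
    exact repl_shift_eq h G ((shift_localCoord (hfl x)).trans (shift_localCoord hx).symm)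
  refine ⟨⟨g, hg⟩, fun x => repl_mem h _ _, fun x hx => ?_⟩
  have hd : ∀ y, dist x (shift (fun i => ⌊x i⌋) y) ≤ 1 := fun y => by
    refine (dist_pi_le_iff zero_le_one).2 fun i => ?_
    have h1 := hfl x i (mem_univ i)
    rw [Real.dist_eq, abs_le]
    change _ ≤ x i - (⌊x i⌋ + (y i : ℝ)) ∧ x i - (⌊x i⌋ + (y i : ℝ)) ≤ _
    constructor <;> linarith [h1.1, h1.2, (y i).2.1, (y i).2.2]
  change repl O n _ _ = _
  rw [repl_of_mem fun y => hA x hx _ (hd y), ContinuousMap.comp_apply, shift_localCoord (hfl x)]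

/-- A map defined on Euclidean space which sends a compact set into an open set with extension
properties can be modified outside of the compact set to a map into the open set. -/
theorem exists_extension (h : ∀ j ≤ n, HE j O) (hO : IsOpen O) (G : C(Fin n → ℝ, E))
    {A : Set (Fin n → ℝ)} (hA : IsCompact A) (hGA : ∀ x ∈ A, G x ∈ O) :
    ∃ G' : C(Fin n → ℝ, E), (∀ x, G' x ∈ O) ∧ ∀ x ∈ A, G' x = G x := by
  obtain ⟨δ, hδ, hδA⟩ := hA.exists_thickening_subset_open (hO.preimage G.continuous) hGA
  have h2 : δ / 2 ≠ 0 := by positivity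
  obtain ⟨G', hG', hGA'⟩ := exists_extension_of_unit_thickening h
    (G.comp ⟨fun x => (δ / 2) • x, by fun_prop⟩) (A := {x | (δ / 2) • x ∈ A}) fun x hx y hxy => by
      refine hδA (mem_thickening_iff.2 ⟨_, hx, ?_⟩)
      rw [ContinuousMap.coe_mk, dist_smul₀, dist_comm, Real.norm_of_nonneg (by positivity)]
      nlinarith
  refine ⟨G'.comp ⟨fun x => (δ / 2)⁻¹ • x, by fun_prop⟩, fun x => hG' _, fun x hx => ?_⟩
  have h3 : (δ / 2) • (δ / 2)⁻¹ • x = x := smul_inv_smul₀ h2 x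
  rw [ContinuousMap.comp_apply, hGA', ContinuousMap.comp_apply]
  · exact congrArg G h3
  · rw [mem_ofPred]
    exact h3.symm ▸ hx

end

/-- A map defined near `P` extends to a compact space `X` embedded off `P` in a Euclidean space
of dimension `n`, provided that the cubical extension property holds in the target. -/
lemma exists_glued_extension {X E Z : Type} [TopologicalSpace X] [CompactSpace X] [T2Space X]
    [TopologicalSpace E] [TietzeExtension.{0} E] [TopologicalSpace Z] {n : ℕ} {O : Set E}
    (hO : IsOpen O) (h : ∀ j ≤ n, HE j O) {e : E → Z} (he : Topology.IsEmbedding e)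
    {P V : Set X} (hP : IsClosed P) (hV : IsClosed V) (hPV : ∀ x ∈ P, V ∈ nhds x)
    {φ : X → Fin n → ℝ} (hφ : ContinuousOn φ Pᶜ) (hφi : InjOn φ Pᶜ)
    {H : X → Z} (hH : ContinuousOn H V) (hHO : ∀ x ∈ V \ P, H x ∈ e '' O) :
    ∃ f : X → Z, Continuous f ∧ (∀ x ∈ V, f x = H x) ∧ ∀ x ∉ V, f x ∈ e '' O := by
  classical
  obtain ⟨B, hB, hVB, hBP⟩ := exists_compact_between
    (isOpen_interior (s := V)).isClosed_compl.isCompact hP.isOpen_compl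
    (compl_subset_compl.2 fun x hx => mem_interior_iff_mem_nhds.2 (hPV x hx))
  have hBV : IsCompact (B ∩ V) := hB.inter_right hV
  have hsub : B ∩ V ⊆ V \ P := fun x hx => ⟨hx.2, hBP hx.1⟩
  choose g hgO hg using fun x : ↥(B ∩ V) => hHO x (hsub x.2)
  have hgc : Continuous g := by
    rw [he.continuous_iff]
    have : e ∘ g = (B ∩ V).domRestrict H := funext hg
    rw [this]
    exact (hH.mono inter_subset_right).domRestrict
  have : CompactSpace ↥(B ∩ V) := isCompact_iff_compactSpace.1 hBV
  have hφB : Topology.IsClosedEmbedding ((B ∩ V).domRestrict φ) :=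
    (hφ.mono fun x hx => (hsub hx).2).domRestrict.isClosedEmbedding
      (hφi.mono fun x hx => (hsub hx).2).injective
  obtain ⟨G, hG⟩ := ContinuousMap.exists_extension' hφB ⟨g, hgc⟩
  have hGx (x : ↥(B ∩ V)) : G (φ x) = g x := congrFun hG x
  obtain ⟨G', hG'O, hG'⟩ := exists_extension h hO G
    (hBV.image_of_continuousOn (hφ.mono fun x hx => (hsub hx).2)) (by
      rintro _ ⟨x, hx, rfl⟩
      rw [hGx ⟨x, hx⟩]
      exact hgO _)
  refine ⟨fun x => if x ∈ V then H x else e (G' (φ x)), ?_, fun x hx => if_pos hx,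
    fun x hx => by simpa only [if_neg hx] using mem_image_of_mem e (hG'O _)⟩
  have hBe : EqOn (fun x => if x ∈ V then H x else e (G' (φ x))) (fun x => e (G' (φ x))) B := by
    intro x hxB
    by_cases hx : x ∈ V
    · simp only [if_pos hx]
      rw [hG' _ (mem_image_of_mem φ ⟨hxB, hx⟩), hGx ⟨x, hxB, hx⟩, hg]
    · simp only [if_neg hx]
  have hVe : EqOn (fun x => if x ∈ V then H x else e (G' (φ x))) H V := fun x hx => if_pos hx
  rw [continuous_iff_continuousAt]
  intro x
  by_cases hx : x ∈ interior V
  · exact (hH.congr hVe).continuousAt (mem_interior_iff_mem_nhds.1 hx)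
  · refine ContinuousOn.continuousAt (s := B) ?_ (mem_interior_iff_mem_nhds.1 (hVB hx))
    exact ((he.continuous.comp G'.continuous).comp_continuousOn (hφ.mono hBP)).congr hBe

lemma isOpen_sdiff_connectedComponentIn {Y : Type*} [TopologicalSpace Y]
    [LocallyConnectedSpace Y] {F : Set Y} (hF : IsOpen F) (x : Y) :
    IsOpen (F \ connectedComponentIn F x) := by
  refine isOpen_iff_mem_nhds.2 fun y hy => Filter.mem_of_superset
    (hF.connectedComponentIn.mem_nhds (mem_connectedComponentIn hy.1)) fun z hz =>
      ⟨connectedComponentIn_subset _ _ hz, fun hzx => hy.2 ?_⟩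
  rw [connectedComponentIn_eq hzx, ← connectedComponentIn_eq hz]
  exact mem_connectedComponentIn hy.1

/-- The complement of a point in a Euclidean sphere is parametrized by a Euclidean space. -/
lemma exists_chart {n : ℕ} {p : Amb n} (hp : p ∈ Sph n) :
    ∃ e : EuclideanSpace ℝ (Fin n) → Amb n, Topology.IsEmbedding e ∧ range e = Sph n \ {p} := by
  have : Fact (Module.finrank ℝ (Amb n) = n + 1) := ⟨by simp⟩
  let s := stereographic' n (⟨p, hp⟩ : sphere (0 : Amb n) 1)
  let t : EuclideanSpace ℝ (Fin n) ≃ₜ s.source :=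
    ((Homeomorph.Set.univ _).symm.trans
      (Homeomorph.setCongr (stereographic'_target _).symm)).trans s.toHomeomorphSourceTarget.symm
  refine ⟨fun x => ((t x : sphere (0 : Amb n) 1) : Amb n),
    (Topology.IsEmbedding.subtypeVal.comp Topology.IsEmbedding.subtypeVal).comp t.isEmbedding, ?_⟩
  have : (fun x => ((t x : sphere (0 : Amb n) 1) : Amb n)) =
      (Subtype.val ∘ Subtype.val) ∘ t := rfl
  rw [this, range_comp, t.surjective.range_eq, image_univ, range_comp, Subtype.range_coe,
    stereographic'_source]
  ext y
  simp only [mem_image, mem_compl_iff, mem_singleton_iff, Subtype.exists, mem_sdiff, Sph]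
  constructor
  · rintro ⟨a, ha, hne, rfl⟩
    exact ⟨ha, fun h => hne (Subtype.ext h)⟩
  · rintro ⟨hy, hne⟩
    exact ⟨y, hy, fun h => hne (congrArg Subtype.val h), rfl⟩

end Cubical

namespace CrumpledCube

variable {n : ℕ} (D : CrumpledCube n)

lemma isCompact_bd : IsCompact D.bd := by
  obtain ⟨e, he, -, hr⟩ := D.exists_embedding
  have : CompactSpace ↥(Sph (n - 1)) := isCompact_iff_compactSpace.1 (isCompact_sphere 0 1)
  exact hr ▸ isCompact_range he

lemma int_subset : D.int ⊆ Sph n \ D.bd := by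
  obtain ⟨x, -, hx⟩ := D.int_component
  exact hx ▸ connectedComponentIn_subset _ _

lemma bd_nonempty : D.bd.Nonempty := by
  obtain ⟨e, -, -, hr⟩ := D.exists_embedding
  obtain ⟨x, hx⟩ :=
    (NormedSpace.sphere_nonempty (E := Amb (n - 1)) (x := 0) (r := 1)).2 zero_le_one
  exact hr ▸ ⟨e ⟨x, hx⟩, mem_range_self _⟩

lemma isCompact_carrier : IsCompact D.carrier := by
  refine (isCompact_sphere (0 : Amb n) 1).of_isClosed_subset ?_
    (union_subset D.bd_subset_sphere (D.int_subset.trans sdiff_subset))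
  obtain ⟨x, hx, hDint⟩ := D.int_component
  refine isClosed_of_closure_subset fun y hy => ?_
  by_cases hyb : y ∈ D.bd
  · exact Or.inl hyb
  rw [carrier, closure_union, D.isCompact_bd.isClosed.closure_eq] at hy
  have hyc : y ∈ closure D.int := hy.resolve_left hyb
  have hyS : y ∈ Sph n := closure_minimal (D.int_subset.trans sdiff_subset)
    (isClosed_sphere (x := (0 : Amb n))) hyc
  have hpc : IsPreconnected (insert y D.int) :=
    (show IsPreconnected D.int from hDint ▸ isPreconnected_connectedComponentIn).subset_closure
      (subset_insert y _) (insert_subset hyc subset_closure)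
  refine Or.inr ?_
  rw [hDint]
  exact hpc.subset_connectedComponentIn
    (mem_insert_of_mem _ (hDint ▸ mem_connectedComponentIn hx))
    (insert_subset (show y ∈ Sph n \ D.bd from ⟨hyS, hyb⟩) D.int_subset) (mem_insert _ _)

open Cubical in
/-- In a chart of the sphere around a simply connected interior, the cubical extension property
holds in all degrees. -/
lemma he_int (hn : 2 ≤ n) (hsc : SimplyConnectedSpace D.int) {p : Amb n} (hp : p ∈ D.bd)
    {e : EuclideanSpace ℝ (Fin n) → Amb n} (he : Topology.IsEmbedding e)
    (hr : range e = Sph n \ {p}) :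
    IsOpen (e ⁻¹' D.int) ∧ ∀ j, HE j (e ⁻¹' D.int) := by
  obtain ⟨m, rfl⟩ : ∃ m, n = m + 1 := ⟨n - 1, by omega⟩
  obtain ⟨x, hx, hDint⟩ := D.int_component
  obtain ⟨g, hg, hgi, hgr⟩ : ∃ g : ↥(Sph m) → Amb (m + 1),
      Continuous g ∧ Function.Injective g ∧ range g = D.bd := D.exists_embedding
  rw [← hgr] at hp
  obtain ⟨q, rfl⟩ := hp
  obtain ⟨c, hc, hcr⟩ := exists_chart (n := m) q.2
  have hbd : IsClosed (e ⁻¹' D.bd) := D.isCompact_bd.isClosed.preimage he.continuous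
  have hcS (y) : c y ∈ Sph m := (hcr ▸ mem_range_self y : c y ∈ Sph m \ {(q : Amb m)}).1
  have hcq (y) : c y ≠ q := (hcr ▸ mem_range_self y : c y ∈ Sph m \ {(q : Amb m)}).2
  have : CompactSpace ↥(Sph m) := isCompact_iff_compactSpace.1 (isCompact_sphere 0 1)
  have hge : Topology.IsEmbedding g := (Continuous.isClosedEmbedding hg hgi).isEmbedding
  have hgS (y) : g y ∈ D.bd := hgr ▸ mem_range_self y
  have hgc : Topology.IsEmbedding fun y => g ⟨c y, hcS y⟩ :=
    hge.comp (Topology.IsEmbedding.of_comp (by exact hc.continuous.codRestrict hcS)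
      continuous_subtype_val hc)
  have hψ (y) : ∃ z : EuclideanSpace ℝ (Fin (m + 1)), e z = g ⟨c y, hcS y⟩ := by
    change g ⟨c y, hcS y⟩ ∈ range e
    rw [hr]
    exact ⟨D.bd_subset_sphere (hgS _), fun h => hcq y (congrArg Subtype.val (hgi h))⟩
  choose ψ hψe using hψ
  have hψc : e ∘ ψ = fun y => g ⟨c y, hcS y⟩ := funext hψe
  have hψr : range ψ = e ⁻¹' D.bd := by
    ext z
    constructor
    · rintro ⟨y, rfl⟩
      rw [mem_preimage, hψe]
      exact hgS _
    · intro hz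
      rw [mem_preimage, ← hgr] at hz
      obtain ⟨w, hw⟩ := hz
      have hwq : (w : Amb m) ∈ range c := by
        rw [hcr]
        refine ⟨w.2, fun h => ?_⟩
        have hzr : e z ∈ Sph (m + 1) \ {g q} := hr ▸ mem_range_self z
        exact hzr.2 (by rw [← hw, Subtype.ext h]; rfl)
      obtain ⟨y, hy⟩ := hwq
      refine ⟨y, he.injective ?_⟩
      rw [hψe, ← hw]
      exact congrArg g (Subtype.ext hy)
  have hψe' : Topology.IsClosedEmbedding ψ :=
    ⟨Topology.IsEmbedding.of_comp (he.continuous_iff.2 (hψc ▸ hgc.continuous)) he.continuous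
      (hψc ▸ hgc), hψr ▸ hbd⟩
  have hDintr : D.int ⊆ range e := fun y hy =>
    hr ▸ ⟨(D.int_subset hy).1, fun h => (D.int_subset hy).2 (h ▸ hgS q)⟩
  have hxi : x ∈ D.int := hDint ▸ mem_connectedComponentIn hx
  obtain ⟨x', rfl⟩ := hDintr hxi
  have hsub : e ⁻¹' D.int ⊆ (e ⁻¹' D.bd)ᶜ := fun y hy => (D.int_subset hy).2
  have hO : e ⁻¹' D.int = connectedComponentIn (e ⁻¹' D.bd)ᶜ x' := by
    refine Subset.antisymm (IsPreconnected.subset_connectedComponentIn ?_ hxi hsub) ?_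
    · rw [← he.isInducing.isPreconnected_image, image_preimage_eq_of_subset hDintr, hDint]
      exact isPreconnected_connectedComponentIn
    · rw [← image_subset_iff, hDint]
      refine (isPreconnected_connectedComponentIn.image e
        he.continuous.continuousOn).subset_connectedComponentIn
        (mem_image_of_mem e (mem_connectedComponentIn (hsub hxi))) ?_
      rintro _ ⟨y, hy, rfl⟩
      have hyr : e y ∈ Sph (m + 1) \ {g q} := hr ▸ mem_range_self y
      exact ⟨hyr.1, connectedComponentIn_subset _ _ hy⟩
  have hOo : IsOpen (e ⁻¹' D.int) := hO ▸ hbd.isOpen_compl.connectedComponentIn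
  have hOc : IsOpen ((e ⁻¹' D.bd)ᶜ \ e ⁻¹' D.int) :=
    hO ▸ isOpen_sdiff_connectedComponentIn hbd.isOpen_compl x'
  have hsc' : SimplyConnectedSpace ↥(e ⁻¹' D.int) :=
    (he.homeomorphOfSubsetRange hDintr).toHomotopyEquiv.simplyConnectedSpace
  exact ⟨hOo, HE.of_van hsc' fun l =>
    (hψr ▸ van_compl_range hψe' (l + 1) : Van (l + 1) (e ⁻¹' D.bd)ᶜ).of_isClopen hsub hOo hOc⟩

end CrumpledCube

/-- **Theorem 3.2.** If `Bd C` and `Bd D` have closed neighborhoods `U_C ⊆ C`, `U_D ⊆ D`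
homeomorphic via `H` carrying `Bd C` to `Bd D`, and `Int D` is simply connected, then
`(C, D, H|_{Bd C}) ∈ 𝒲_n`. -/
theorem stmt1 (n : ℕ) (hn : 2 ≤ n) (C D : CrumpledCube n)
    (UC : Set ↥C.carrier) (UD : Set ↥D.carrier)
    (hUCc : IsClosed UC) (hUDc : IsClosed UD)
    (hUCn : ∀ x : ↥C.carrier, (x : Amb n) ∈ C.bd → UC ∈ nhds x)
    (hUDn : ∀ y : ↥D.carrier, (y : Amb n) ∈ D.bd → UD ∈ nhds y)
    (H : ↥UC ≃ₜ ↥UD)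
    (hHbd : ∀ x : ↥UC, ((x : ↥C.carrier) : Amb n) ∈ C.bd ↔
      (((H x : ↥UD) : ↥D.carrier) : Amb n) ∈ D.bd)
    (hsc : SimplyConnectedSpace ↥D.int)
    (h : ↥C.bd ≃ₜ ↥D.bd)
    (hh : ∀ (x : ↥C.bd) (hx : (⟨(x : Amb n), C.bd_subset_carrier x.2⟩ : ↥C.carrier) ∈ UC),
      ((h x : ↥D.bd) : Amb n) =
        (((H ⟨⟨(x : Amb n), C.bd_subset_carrier x.2⟩, hx⟩ : ↥UD) : ↥D.carrier) : Amb n)) :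
    MemW C D h := by
  classical
  obtain ⟨p, hp⟩ := D.bd_nonempty
  obtain ⟨q, hq⟩ := C.bd_nonempty
  obtain ⟨e, he, her⟩ := Cubical.exists_chart (D.bd_subset_sphere hp)
  obtain ⟨c, hc, hcr⟩ := Cubical.exists_chart (C.bd_subset_sphere hq)
  obtain ⟨hO, hHE⟩ := D.he_int hn hsc hp he her
  have hDe : e '' (e ⁻¹' D.int) = D.int := image_preimage_eq_of_subset fun y hy =>
    her ▸ ⟨(D.int_subset hy).1, fun h => (D.int_subset hy).2 (h ▸ hp)⟩
  have : CompactSpace ↥C.carrier := isCompact_iff_compactSpace.1 C.isCompact_carrier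
  have hcφ (x : ↥C.carrier) (hx : (x : Amb n) ∉ C.bd) : c (Function.invFun c x) = x :=
    Function.invFun_eq (hcr ▸ ⟨(C.int_subset (x.2.resolve_left hx)).1, fun h => hx (h ▸ hq)⟩ :
      (x : Amb n) ∈ range c)
  have hφ : ContinuousOn (fun x : ↥C.carrier => Function.invFun c x)
      {x : ↥C.carrier | (x : Amb n) ∈ C.bd}ᶜ :=
    hc.isInducing.continuousOn_iff.2 (continuous_subtype_val.continuousOn.congr hcφ)
  let k : ↥C.carrier → Amb n := fun x => if hx : x ∈ UC then H ⟨x, hx⟩ else p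
  have hk (x : ↥C.carrier) (hx : x ∈ UC) : k x = H ⟨x, hx⟩ := dif_pos hx
  obtain ⟨f, hf, hfU, hfO⟩ := Cubical.exists_glued_extension (n := n) hO (fun j _ => hHE j) he
    (C.isCompact_bd.isClosed.preimage continuous_subtype_val) hUCc hUCn
    (φ := fun x => (Function.invFun c x).ofLp)
    ((PiLp.continuous_ofLp 2 _).comp_continuousOn hφ)
    (fun x hx y hy hxy => Subtype.ext <| by
      rw [← hcφ x hx, ← hcφ y hy, WithLp.ofLp_injective 2 hxy])
    (H := k)
    (by
      rw [continuousOn_iff_continuous_domRestrict]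
      have : UC.domRestrict k = fun x => (((H x : ↥UD) : ↥D.carrier) : Amb n) :=
        funext fun x => hk x x.2
      rw [this]
      fun_prop)
    (fun x hx => by
      rw [hDe, hk x hx.1]
      exact (H ⟨x, hx.1⟩ : ↥UD).1.2.resolve_left fun hb => hx.2 ((hHbd ⟨x, hx.1⟩).2 hb))
  rw [hDe] at hfO
  have hfD (x : ↥C.carrier) : f x ∈ D.carrier := by
    by_cases hx : x ∈ UC
    · rw [hfU x hx, hk x hx]
      exact Subtype.coe_prop _
    · exact Or.inr (hfO x hx)
  refine ⟨fun x => ⟨f x, hfD x⟩, hf.subtype_mk _, fun x hx => ?_, fun x => ?_⟩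
  · have hxU : x ∈ UC := mem_of_mem_nhds (hUCn x hx)
    exact (hfU x hxU).trans ((hk x hxU).trans (hh ⟨x, hx⟩ hxU).symm)
  · by_cases hx : x ∈ UC
    · change f x ∈ D.bd ↔ _
      rw [hfU x hx, hk x hx]
      exact (hHbd ⟨x, hx⟩).symm
    · exact iff_of_false (D.int_subset (hfO x hx)).2 fun hb => hx (mem_of_mem_nhds (hUCn x hb))
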